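/- Let N ≥ 1 and let A be Haar-distributed on the compact symplectic group USp(2N). Then E[ Σ_{k≥1} Tr(A^k)²/k² ] = Σ_{k≥1} (min{k, 2N} + η(k))/k², where η(k) = ε(k) + 1_{{k ≤ N}} − 1_{{k ≤ 2N}} and ε(k) = 1 if k is even and 1 ≤ k ≤ 2N (and ε(k) = 0 otherwise). -/

import Mathlib

open MeasureTheory ProbabilityTheory Matrix

noncomputable section

instance matrixMeasurableSpace {m n α : Type*} [MeasurableSpace α] :
    MeasurableSpace (Matrix m n α) :=
  show MeasurableSpace (m → n → α) from inferInstance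

/-- The standard `2N×2N` skew-symmetric symplectic form `J = [[0, I], [−I, 0]]`. -/
def J (N : ℕ) : Matrix (Fin (2 * N)) (Fin (2 * N)) ℂ :=
  Matrix.of fun i j =>
    if (i : ℕ) + N = (j : ℕ) then 1 else if (j : ℕ) + N = (i : ℕ) then -1 else 0

/-- The compact symplectic group `USp(2N)`: unitary `2N×2N` complex matrices `A` with
`Aᵀ J A = J`. -/
def USp (N : ℕ) : Set (Matrix (Fin (2 * N)) (Fin (2 * N)) ℂ) :=
  {A | A ∈ Matrix.unitaryGroup (Fin (2 * N)) ℂ ∧ Aᵀ * J N * A = J N}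

/-- `ε(k) = 1` if `k` is even and `1 ≤ k ≤ 2N`, and `ε(k) = 0` otherwise. -/
def eps (N k : ℕ) : ℝ :=
  if Even k ∧ 1 ≤ k ∧ k ≤ 2 * N then 1 else 0

/-- `η(k) = ε(k) + 1_{k ≤ N} − 1_{k ≤ 2N}`. -/
def eta (N k : ℕ) : ℝ :=
  eps N k + (if k ≤ N then 1 else 0) - (if k ≤ 2 * N then 1 else 0)

namespace SymplecticTrace

/-- The ring of Laurent polynomials in `N` variables. -/
abbrev TorusRing (N : ℕ) : Type := AddMonoidAlgebra ℂ (Fin N → ℤ)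

variable {N : ℕ}

/-- The power `x_j ^ m` of the `j`-th coordinate of the torus. -/
def coordPow (j : Fin N) (m : ℤ) : TorusRing N := AddMonoidAlgebra.single (Pi.single j m) 1

lemma coordPow_add (j : Fin N) (m n : ℤ) :
    coordPow j (m + n) = coordPow j m * coordPow j n := by
  simp [coordPow, AddMonoidAlgebra.single_mul_single, Pi.single_add]

lemma coordPow_zero (j : Fin N) : coordPow j 0 = 1 := by
  simp [coordPow, AddMonoidAlgebra.one_def]

/-- The algebra homomorphism `f ↦ f + ε x_j ∂f/∂x_j` into the dual numbers. -/
def eulerHom (j : Fin N) : TorusRing N →ₐ[ℂ] TrivSqZeroExt (TorusRing N) (TorusRing N) :=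
  AddMonoidAlgebra.lift ℂ _ _
    { toFun := fun v => TrivSqZeroExt.inl (AddMonoidAlgebra.single v.toAdd 1) +
        TrivSqZeroExt.inr (AddMonoidAlgebra.single v.toAdd ((v.toAdd j : ℤ) : ℂ))
      map_one' := by
        ext1 <;> simp [AddMonoidAlgebra.one_def]
      map_mul' := fun v w => by
        ext1
        · simp [AddMonoidAlgebra.single_mul_single]
        · simp [AddMonoidAlgebra.single_mul_single, add_comm,
            AddMonoidAlgebra.single_add] }

lemma fst_eulerHom (j : Fin N) (f : TorusRing N) : (eulerHom j f).fst = f := by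
  induction f using AddMonoidAlgebra.induction_linear with
  | zero => simp
  | add f g hf hg => simp [hf, hg]
  | single v r => simp [eulerHom, AddMonoidAlgebra.lift_single]

/-- The Euler derivation `x_j ∂/∂x_j`. -/
def euler (j : Fin N) : Derivation ℂ (TorusRing N) (TorusRing N) :=
  Derivation.mk' ((TrivSqZeroExt.sndHom (TorusRing N) (TorusRing N)).restrictScalars ℂ ∘ₗ
    (eulerHom j).toLinearMap) fun a b => by
      simp [fst_eulerHom, mul_comm]

lemma euler_coordPow (i j : Fin N) (m : ℤ) :
    euler i (coordPow j m) = if i = j then (m : TorusRing N) * coordPow j m else 0 := by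
  have h : euler i (coordPow j m) =
      ((Pi.single j m : Fin N → ℤ) i : ℂ) • coordPow j m := by
    simp [euler, eulerHom, coordPow, AddMonoidAlgebra.lift_single]
  rw [h]
  split_ifs with hij
  · subst hij
    simp [← Int.cast_smul_eq_zsmul ℂ, ← zsmul_eq_mul]
  · simp [hij]

/-- `x_j ^ m + x_j ^ (-m)`. -/
def cosPow (j : Fin N) (m : ℤ) : TorusRing N := coordPow j m + coordPow j (-m)

/-- `x_j ^ m - x_j ^ (-m)`. -/
def sinPow (j : Fin N) (m : ℤ) : TorusRing N := coordPow j m - coordPow j (-m)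

lemma cosPow_zero (j : Fin N) : cosPow j 0 = 2 := by
  simp only [cosPow, neg_zero, coordPow_zero]; norm_num

lemma sinPow_zero (j : Fin N) : sinPow j 0 = 0 := by
  simp [sinPow]

lemma cosPow_neg (j : Fin N) (m : ℤ) : cosPow j (-m) = cosPow j m := by
  simp [cosPow, add_comm]

lemma sinPow_neg (j : Fin N) (m : ℤ) : sinPow j (-m) = -sinPow j m := by
  simp [sinPow]

lemma cosPow_mul_cosPow (j : Fin N) (m n : ℤ) :
    cosPow j m * cosPow j n = cosPow j (m + n) + cosPow j (m - n) := by
  simp only [cosPow, sub_eq_add_neg, neg_add, coordPow_add, neg_neg]; ring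

lemma sinPow_mul_sinPow (j : Fin N) (m n : ℤ) :
    sinPow j m * sinPow j n = cosPow j (m + n) - cosPow j (m - n) := by
  simp only [cosPow, sinPow, sub_eq_add_neg, neg_add, coordPow_add, neg_neg]; ring

lemma sinPow_mul_cosPow (j : Fin N) (m n : ℤ) :
    sinPow j m * cosPow j n = sinPow j (m + n) + sinPow j (m - n) := by
  simp only [cosPow, sinPow, sub_eq_add_neg, neg_add, coordPow_add, neg_neg]; ring

lemma euler_cosPow (i j : Fin N) (m : ℤ) :
    euler i (cosPow j m) = if i = j then (m : TorusRing N) * sinPow j m else 0 := by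
  simp only [cosPow, map_add, euler_coordPow, sinPow]
  split_ifs <;> simp; ring

lemma euler_sinPow (i j : Fin N) (m : ℤ) :
    euler i (sinPow j m) = if i = j then (m : TorusRing N) * cosPow j m else 0 := by
  simp only [cosPow, map_sub, euler_coordPow, sinPow]
  split_ifs <;> simp; ring

/-- The image of the trace of the `m`-th power. -/
def powerSum (N : ℕ) (m : ℤ) : TorusRing N := ∑ j : Fin N, cosPow j m

lemma powerSum_neg (m : ℤ) : powerSum N (-m) = powerSum N m := by
  simp [powerSum, cosPow_neg]

lemma powerSum_natAbs (m : ℤ) : powerSum N m.natAbs = powerSum N m := by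
  rcases Int.natAbs_eq m with h | h
  · rw [← h]
  · conv_rhs => rw [h]
    rw [powerSum_neg]

/-- The alternating sum `det (x_j ^ μ_i - x_j ^ (-μ_i))`. -/
def altDet (v : Fin N → ℤ) : TorusRing N := (Matrix.of fun i j => sinPow j (v i)).det

/-- The Weyl vector. -/
def rho (N : ℕ) (i : Fin N) : ℤ := (i : ℤ) + 1

/-- The Weyl denominator. -/
def weylDenom (N : ℕ) : TorusRing N := altDet (rho N)

lemma chebyshevS_monic_natDegree {R : Type*} [CommRing R] [Nontrivial R] (n : ℕ) :
    (Polynomial.Chebyshev.S R n).Monic ∧ (Polynomial.Chebyshev.S R n).natDegree = n := by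
  induction n using Nat.strong_induction_on with
  | _ n ih =>
    match n with
    | 0 => simp
    | 1 => simp
    | n + 2 =>
      obtain ⟨h0, d0⟩ := ih n (by omega)
      obtain ⟨h1, d1⟩ := ih (n + 1) (by omega)
      have h : Polynomial.Chebyshev.S R ((n + 2 : ℕ) : ℤ) =
          Polynomial.X * Polynomial.Chebyshev.S R ((n + 1 : ℕ) : ℤ) -
            Polynomial.Chebyshev.S R (n : ℤ) := by
        push_cast; exact Polynomial.Chebyshev.S_add_two R n
      have hm : (Polynomial.X * Polynomial.Chebyshev.S R ((n + 1 : ℕ) : ℤ)).Monic :=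
        Polynomial.monic_X.mul h1
      have hd : (Polynomial.X * Polynomial.Chebyshev.S R ((n + 1 : ℕ) : ℤ)).natDegree = n + 2 := by
        rw [Polynomial.monic_X.natDegree_mul h1, d1, Polynomial.natDegree_X]; ring
      have hlt : (Polynomial.Chebyshev.S R (n : ℤ)).natDegree <
          (Polynomial.X * Polynomial.Chebyshev.S R ((n + 1 : ℕ) : ℤ)).natDegree := by
        rw [hd, d0]; omega
      rw [h]
      refine ⟨?_, ?_⟩
      · exact hm.sub_of_left (Polynomial.degree_lt_degree hlt)
      · rw [Polynomial.natDegree_sub_eq_left_of_natDegree_lt hlt, hd]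

lemma sinPow_eq_mul_eval (j : Fin N) (n : ℤ) :
    sinPow j (n + 1) =
      sinPow j 1 * (Polynomial.Chebyshev.S (TorusRing N) n).eval (cosPow j 1) := by
  induction n using Polynomial.Chebyshev.induct with
  | zero => simp
  | one =>
    have := sinPow_mul_cosPow j 1 1
    simp [sinPow_zero] at this
    simp [this]
  | add_two n h1 h0 =>
    have := sinPow_mul_cosPow j (n + 2) 1
    rw [Polynomial.Chebyshev.S_add_two]
    simp only [Polynomial.eval_sub, Polynomial.eval_mul, Polynomial.eval_X, mul_sub]
    rw [mul_left_comm, ← h1, ← h0]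
    rw [show (n : ℤ) + 1 + 1 = n + 2 by ring, mul_comm, this,
      show (n : ℤ) + 2 - 1 = n + 1 by ring]
    ring
  | neg_add_one n h1 h0 =>
    have := sinPow_mul_cosPow j (-(n : ℤ) + 1) 1
    rw [Polynomial.Chebyshev.S_sub_one]
    simp only [Polynomial.eval_sub, Polynomial.eval_mul, Polynomial.eval_X, mul_sub]
    rw [mul_left_comm, ← h1, ← h0, mul_comm, this]
    ring_nf

lemma weylDenom_eq_prod :
    weylDenom N = (∏ j : Fin N, sinPow j 1) *
      ∏ i : Fin N, ∏ j ∈ Finset.Ioi i, (cosPow j 1 - cosPow i 1) := by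
  have h := Matrix.det_eval_matrixOfPolynomials_eq_det_vandermonde
    (fun j : Fin N => cosPow j 1)
    (fun i : Fin N => Polynomial.Chebyshev.S (TorusRing N) (i : ℕ))
    (fun i => (chebyshevS_monic_natDegree (R := TorusRing N) (i : ℕ)).2)
    (fun i => (chebyshevS_monic_natDegree (R := TorusRing N) (i : ℕ)).1)
  rw [← Matrix.det_vandermonde, h, ← Matrix.det_mul_column, weylDenom, altDet,
    ← Matrix.det_transpose]
  congr 1
  ext1 i j
  simp [rho, sinPow_eq_mul_eval]

/-- The vector field `∑_j (x_j ^ k - x_j ^ (-k)) x_j ∂/∂x_j`. -/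
def sinField (N : ℕ) (k : ℤ) : Derivation ℂ (TorusRing N) (TorusRing N) :=
  ∑ j, sinPow j k • euler j

lemma sinField_apply (k : ℤ) (f : TorusRing N) :
    sinField N k f = ∑ j, sinPow j k * euler j f := by
  have h := map_sum (Derivation.coeFnAddMonoidHom (R := ℂ) (A := TorusRing N)
    (M := TorusRing N)) (fun j => sinPow j k • euler j) Finset.univ
  refine (congrFun h f).trans ?_
  rw [Finset.sum_apply]
  rfl

lemma sinField_cosPow (k m : ℤ) (j : Fin N) :
    sinField N k (cosPow j m) = (m : TorusRing N) * (sinPow j k * sinPow j m) := by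
  simp [sinField_apply, euler_cosPow]; ring

lemma sinField_sinPow (k m : ℤ) (j : Fin N) :
    sinField N k (sinPow j m) = (m : TorusRing N) * (sinPow j k * cosPow j m) := by
  simp [sinField_apply, euler_sinPow]; ring

lemma two_mul_derivation_prod {R A ι : Type*} [CommRing R] [CommRing A] [Algebra R A]
    (D : Derivation R A A) (s : Finset ι) (f g : ι → A)
    (h : ∀ i ∈ s, 2 * D (f i) = f i * g i) :
    2 * D (∏ i ∈ s, f i) = (∏ i ∈ s, f i) * ∑ i ∈ s, g i := by
  classical
  induction s using Finset.induction_on with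
  | empty => simp
  | insert a s ha ih =>
    have h1 := h a (by simp)
    have h2 := ih fun i hi => h i (by simp [hi])
    rw [Finset.prod_insert ha, Finset.sum_insert ha, Derivation.leibniz]
    simp only [smul_eq_mul]
    linear_combination f a * h2 + (∏ i ∈ s, f i) * h1

/-- The interaction of two coordinates under `sinField`. -/
def pairSum (k : ℕ) (i j : Fin N) : TorusRing N :=
  ∑ m ∈ Finset.range k, cosPow i m * cosPow j (k - m)

lemma sinPow_mul_cosPow_one (j : Fin N) (k : ℕ) :
    sinPow j k * cosPow j 1 =
      sinPow j 1 * ∑ m ∈ Finset.range k, cosPow j ((k : ℤ) - 2 * m) := by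
  have h : ∀ m ∈ Finset.range k, sinPow j 1 * cosPow j ((k : ℤ) - 2 * m) =
      sinPow j ((k : ℤ) - 2 * m + 1) - sinPow j ((k : ℤ) - 2 * (m + 1 : ℕ) + 1) := by
    intro m _
    rw [sinPow_mul_cosPow, show (k : ℤ) - 2 * (m + 1 : ℕ) + 1 = -(1 - ((k : ℤ) - 2 * m)) by
      push_cast; ring, sinPow_neg, add_comm 1]
    ring
  rw [Finset.mul_sum, Finset.sum_congr rfl h,
    Finset.sum_range_sub' fun m : ℕ => sinPow j ((k : ℤ) - 2 * m + 1), sinPow_mul_cosPow,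
    show (k : ℤ) - 2 * k + 1 = -(k - 1) by ring, sinPow_neg]
  simp

lemma cosPow_sub_mul_pairSum (k : ℕ) (i j : Fin N) :
    (cosPow j 1 - cosPow i 1) * pairSum k i j =
      2 * cosPow j (k + 1) + 2 * cosPow i (k - 1) - cosPow i k * cosPow j 1
        - cosPow i 1 * cosPow j k := by
  have h : ∀ m ∈ Finset.range k,
      (cosPow j 1 - cosPow i 1) * (cosPow i m * cosPow j (k - m)) =
      (cosPow i m * cosPow j (k - m + 1) - cosPow i (m - 1) * cosPow j (k - m)) -
      (cosPow i (m + 1 : ℕ) * cosPow j (k - (m + 1 : ℕ) + 1) -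
        cosPow i ((m + 1 : ℕ) - 1) * cosPow j (k - (m + 1 : ℕ))) := by
    intro m _
    have h1 := cosPow_mul_cosPow j (k - m) 1
    have h2 := cosPow_mul_cosPow i m 1
    push_cast
    rw [show (k : ℤ) - (m + 1) + 1 = k - m by ring, show (m : ℤ) + 1 - 1 = m by ring,
      show (k : ℤ) - (m + 1) = k - m - 1 by ring]
    linear_combination cosPow i m * h1 - cosPow j (k - m) * h2
  rw [pairSum, Finset.mul_sum, Finset.sum_congr rfl h,
    Finset.sum_range_sub' fun m : ℕ => cosPow i m * cosPow j (k - m + 1) -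
      cosPow i (m - 1) * cosPow j (k - m)]
  simp [cosPow_zero, cosPow_neg]
  ring

lemma two_mul_sinField_weylDenom (k : ℕ) :
    2 * sinField N k (weylDenom N) = weylDenom N *
      (∑ j : Fin N, 2 * ∑ m ∈ Finset.range k, cosPow j ((k : ℤ) - 2 * m) +
        ∑ i : Fin N, ∑ j ∈ Finset.Ioi i, (pairSum k i j + pairSum k j i)) := by
  have h1 := two_mul_derivation_prod (sinField N k) Finset.univ (fun j => sinPow j 1)
    (fun j => 2 * ∑ m ∈ Finset.range k, cosPow j ((k : ℤ) - 2 * m)) (fun j _ => by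
      have := sinPow_mul_cosPow_one j k
      simp only [sinField_sinPow, this]
      push_cast; ring)
  have h2 := two_mul_derivation_prod (sinField N k) Finset.univ
    (fun i : Fin N => ∏ j ∈ Finset.Ioi i, (cosPow j 1 - cosPow i 1)) _ (fun i _ =>
      two_mul_derivation_prod (sinField N k) (Finset.Ioi i)
        (fun j => cosPow j 1 - cosPow i 1) (fun j => pairSum k i j + pairSum k j i)
        (fun j _ => by
          have e1 := cosPow_sub_mul_pairSum k i j
          have e2 := cosPow_sub_mul_pairSum k j i
          have e3 := sinPow_mul_sinPow i k 1
          have e4 := sinPow_mul_sinPow j k 1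
          simp only [map_sub, sinField_cosPow]
          push_cast
          linear_combination -e1 + e2 - 2 * e3 + 2 * e4))
  rw [weylDenom_eq_prod, Derivation.leibniz]
  simp only [smul_eq_mul]
  linear_combination (∏ j : Fin N, sinPow j 1) * h2 +
    (∏ i : Fin N, ∏ j ∈ Finset.Ioi i, (cosPow j 1 - cosPow i 1)) * h1

lemma sum_pairSum_eq (k : ℕ) :
    ∑ m ∈ Finset.range k, (powerSum N m * powerSum N (k - m) + powerSum N ((k : ℤ) - 2 * m)) =
      (∑ j : Fin N, 2 * ∑ m ∈ Finset.range k, cosPow j ((k : ℤ) - 2 * m) +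
        ∑ i : Fin N, ∑ j ∈ Finset.Ioi i, (pairSum k i j + pairSum k j i)) +
      ∑ j : Fin N, (k : TorusRing N) * cosPow j k := by
  have h1 : ∑ m ∈ Finset.range k, powerSum N m * powerSum N (k - m) =
      ∑ i : Fin N, ∑ j : Fin N, pairSum k i j := by
    simp only [powerSum, Finset.sum_mul_sum, pairSum]
    rw [Finset.sum_comm]
    refine Finset.sum_congr rfl fun i _ => ?_
    rw [Finset.sum_comm]
  have hdiag : ∀ i : Fin N, pairSum k i i = (k : TorusRing N) * cosPow i k +
      ∑ m ∈ Finset.range k, cosPow i ((k : ℤ) - 2 * m) := by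
    intro i
    have : ∀ m ∈ Finset.range k, cosPow i m * cosPow i (k - m) =
        cosPow i k + cosPow i ((k : ℤ) - 2 * m) := by
      intro m _
      rw [cosPow_mul_cosPow, ← cosPow_neg i (m - (k - m))]
      ring_nf
    rw [pairSum, Finset.sum_congr rfl this, Finset.sum_add_distrib]
    simp
  have h2 : ∑ i : Fin N, ∑ j : Fin N, pairSum k i j = ∑ i : Fin N, pairSum k i i +
      ∑ i : Fin N, ∑ j ∈ Finset.Ioi i, (pairSum k i j + pairSum k j i) := by
    have e : ∀ i : Fin N, ∑ j : Fin N, pairSum k i j = pairSum k i i +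
        (∑ j ∈ Finset.Ioi i, pairSum k i j + ∑ j ∈ Finset.Iio i, pairSum k i j) := by
      intro i
      rw [← Finset.sum_filter_add_sum_filter_not Finset.univ (fun j => i < j),
        ← Finset.sum_filter_add_sum_filter_not (Finset.univ.filter fun j => ¬ i < j)
          (fun j => j < i), Finset.filter_filter, Finset.filter_filter]
      have s1 : Finset.univ.filter (fun j => i < j) = Finset.Ioi i := by ext; simp
      have s2 : Finset.univ.filter (fun j => ¬ i < j ∧ j < i) = Finset.Iio i := by
        ext; simp; exact le_of_lt
      have s3 : Finset.univ.filter (fun j => ¬ i < j ∧ ¬ j < i) = {i} := by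
        ext j; simp; exact ⟨fun h => le_antisymm h.1 h.2, fun h => by simp [h]⟩
      rw [s1, s2, s3, Finset.sum_singleton]
      ring
    rw [Finset.sum_congr rfl fun i _ => e i]
    simp only [Finset.sum_add_distrib]
    congr 2
    refine Finset.sum_comm' ?_
    simp
  rw [Finset.sum_add_distrib, h1, h2, Finset.sum_congr rfl fun i _ => hdiag i]
  simp only [Finset.sum_add_distrib, ← Finset.mul_sum, powerSum]
  rw [Finset.sum_comm (s := Finset.range k)]
  ring

/-- Polynomials in the formal traces `tr A ^ n`. -/
abbrev TracePoly : Type := MvPolynomial ℕ ℂ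

/-- Restriction of a trace polynomial to the torus. -/
def toTorus (N : ℕ) : TracePoly →ₐ[ℂ] TorusRing N :=
  MvPolynomial.aeval fun n : ℕ => powerSum N n

lemma toTorus_X (n : ℕ) : toTorus N (MvPolynomial.X n) = powerSum N n := by
  simp [toTorus]

/-- The divergence term of the Schwinger–Dyson operator. -/
def splitPoly (k : ℕ) : TracePoly :=
  ∑ m ∈ Finset.range k, (MvPolynomial.X m * MvPolynomial.X (k - m) +
    MvPolynomial.X ((k : ℤ) - 2 * m).natAbs)

/-- The first order part of the Schwinger–Dyson operator. -/
def joinField (k : ℕ) : Derivation ℂ TracePoly TracePoly :=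
  MvPolynomial.mkDerivation ℂ fun l : ℕ => (l : TracePoly) *
    (MvPolynomial.X (k + l) - MvPolynomial.X ((k : ℤ) - l).natAbs)

/-- The Schwinger–Dyson operator. -/
def schwingerDyson (k : ℕ) (f : TracePoly) : TracePoly := splitPoly k * f + joinField k f

lemma sinField_powerSum (k l : ℕ) : sinField N k (powerSum N l) =
    (l : TorusRing N) * (powerSum N (k + l) - powerSum N (k - l)) := by
  simp only [powerSum, map_sum, sinField_cosPow, sinPow_mul_sinPow, ← Finset.mul_sum,
    Finset.sum_sub_distrib]
  push_cast; rfl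

lemma toTorus_joinField (k : ℕ) (f : TracePoly) :
    toTorus N (joinField k f) = sinField N k (toTorus N f) := by
  induction f using MvPolynomial.induction_on with
  | C a => simp only [← MvPolynomial.algebraMap_eq, AlgHom.commutes, Derivation.map_algebraMap,
      map_zero]
  | add f g hf hg => simp [hf, hg]
  | mul_X f n hf =>
    simp only [Derivation.leibniz, smul_eq_mul, map_add, map_mul, hf, toTorus_X,
      sinField_powerSum]
    simp only [joinField, MvPolynomial.mkDerivation_X, map_mul, map_sub, toTorus_X,
      powerSum_natAbs, map_natCast, Nat.cast_add]

lemma weylDenom_mul_toTorus_schwingerDyson (k : ℕ) (f : TracePoly) :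
    weylDenom N * toTorus N (schwingerDyson k f) =
      2 * sinField N k (weylDenom N) * toTorus N f +
        weylDenom N * ((∑ j : Fin N, (k : TorusRing N) * cosPow j k) * toTorus N f +
          sinField N k (toTorus N f)) := by
  have h : toTorus N (splitPoly k) = ∑ m ∈ Finset.range k,
      (powerSum N m * powerSum N (k - m) + powerSum N ((k : ℤ) - 2 * m)) := by
    simp only [splitPoly, map_sum, map_add, map_mul, toTorus_X, powerSum_natAbs]
    refine Finset.sum_congr rfl fun m hm => ?_
    rw [Nat.cast_sub (Finset.mem_range.1 hm).le]
  rw [schwingerDyson, map_add, map_mul, h, sum_pairSum_eq, toTorus_joinField,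
    two_mul_sinField_weylDenom]
  ring

/-- The flat Laplacian on the torus. -/
def torusLaplacian (f : TorusRing N) : TorusRing N := ∑ j, euler j (euler j f)

lemma euler_toTorus (f : TracePoly) : ∃ n : ℕ, ∀ m ≥ n, ∀ j : Fin N,
    euler j (toTorus N f) = ∑ l ∈ Finset.range m,
      (l : TorusRing N) * (sinPow j l * toTorus N (MvPolynomial.pderiv l f)) := by
  induction f using MvPolynomial.induction_on with
  | C a => exact ⟨0, fun m _ j => by simp only [← MvPolynomial.algebraMap_eq, AlgHom.commutes,
      Derivation.map_algebraMap, map_zero, mul_zero, Finset.sum_const_zero]⟩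
  | add f g hf hg =>
    obtain ⟨a, ha⟩ := hf
    obtain ⟨b, hb⟩ := hg
    refine ⟨max a b, fun m hm j => ?_⟩
    rw [map_add, map_add, ha m (le_trans (le_max_left _ _) hm),
      hb m (le_trans (le_max_right _ _) hm), ← Finset.sum_add_distrib]
    refine Finset.sum_congr rfl fun l _ => ?_
    rw [map_add, map_add]; ring
  | mul_X f i hf =>
    obtain ⟨a, ha⟩ := hf
    refine ⟨max a (i + 1), fun m hm j => ?_⟩
    have hi : i ∈ Finset.range m :=
      Finset.mem_range.2 (lt_of_lt_of_le (Nat.lt_succ_self i) (le_trans (le_max_right _ _) hm))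
    have h1 : ∀ l ∈ Finset.range m, (l : TorusRing N) *
        (sinPow j l * toTorus N (MvPolynomial.pderiv l (f * MvPolynomial.X i))) =
        powerSum N i * ((l : TorusRing N) * (sinPow j l * toTorus N (MvPolynomial.pderiv l f))) +
        if i = l then (i : TorusRing N) * (sinPow j i * toTorus N f) else 0 := by
      intro l _
      rw [Derivation.leibniz, MvPolynomial.pderiv_X, map_add]
      simp only [smul_eq_mul, map_mul, toTorus_X]
      split_ifs with h
      · subst h; simp; ring
      · simp [h]; ring
    rw [Finset.sum_congr rfl h1, Finset.sum_add_distrib, ← Finset.mul_sum,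
      ← ha m (le_trans (le_max_left _ _) hm), Finset.sum_ite_eq, if_pos hi, map_mul,
      Derivation.leibniz, toTorus_X]
    have : euler j (powerSum N i) = (i : TorusRing N) * sinPow j i := by
      simp [powerSum, euler_cosPow]
    rw [this]
    simp only [smul_eq_mul]
    ring

lemma torusLaplacian_mul (f g : TorusRing N) : torusLaplacian (f * g) =
    torusLaplacian f * g + f * torusLaplacian g + 2 * ∑ j, euler j f * euler j g := by
  simp only [torusLaplacian, Derivation.leibniz, smul_eq_mul, map_add, Finset.sum_mul,
    Finset.mul_sum, ← Finset.sum_add_distrib]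
  exact Finset.sum_congr rfl fun j _ => by ring

lemma exists_laplacian_lift (f : TracePoly) : ∃ g : TracePoly,
    (∀ E : TracePoly →ₗ[ℂ] ℂ, (∀ k h, E (schwingerDyson k h) = 0) → E g = 0) ∧
    weylDenom N * toTorus N g = torusLaplacian (weylDenom N * toTorus N f) -
      torusLaplacian (weylDenom N) * toTorus N f := by
  obtain ⟨n, hn⟩ := euler_toTorus (N := N) f
  specialize hn n le_rfl
  refine ⟨∑ l ∈ Finset.range n, (l : ℂ) • schwingerDyson l (MvPolynomial.pderiv l f), ?_, ?_⟩
  · intro E hE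
    simp [hE]
  · have h1 : torusLaplacian (toTorus N f) = ∑ l ∈ Finset.range n, (l : TorusRing N) *
        ((∑ j : Fin N, (l : TorusRing N) * cosPow j l) * toTorus N (MvPolynomial.pderiv l f) +
          sinField N l (toTorus N (MvPolynomial.pderiv l f))) := by
      simp only [torusLaplacian, hn, map_sum]
      rw [Finset.sum_comm]
      refine Finset.sum_congr rfl fun l _ => ?_
      rw [sinField_apply, Finset.sum_mul, ← Finset.sum_add_distrib, Finset.mul_sum]
      refine Finset.sum_congr rfl fun j _ => ?_
      simp only [Derivation.leibniz, euler_sinPow, if_true, smul_eq_mul, Derivation.map_natCast,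
        Int.cast_natCast]
      ring
    have h2 : ∑ j, euler j (weylDenom N) * euler j (toTorus N f) = ∑ l ∈ Finset.range n,
        (l : TorusRing N) * (sinField N l (weylDenom N) *
          toTorus N (MvPolynomial.pderiv l f)) := by
      simp only [hn, Finset.mul_sum, sinField_apply, Finset.sum_mul]
      rw [Finset.sum_comm]
      exact Finset.sum_congr rfl fun l _ => Finset.sum_congr rfl fun j _ => by ring
    rw [torusLaplacian_mul, h1, h2, map_sum, Finset.mul_sum, Finset.mul_sum, Finset.mul_sum]
    rw [add_assoc, add_sub_cancel_left, ← Finset.sum_add_distrib]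
    refine Finset.sum_congr rfl fun l _ => ?_
    have := weylDenom_mul_toTorus_schwingerDyson (N := N) l (MvPolynomial.pderiv l f)
    rw [map_smul, ← algebraMap_smul (TorusRing N) (l : ℂ), map_natCast, smul_eq_mul]
    linear_combination (l : TorusRing N) * this

/-- The squared length of a weight. -/
def normSq (v : Fin N → ℤ) : ℤ := ∑ i, v i ^ 2

instance : CharZero (TorusRing N) :=
  charZero_of_injective_algebraMap (algebraMap ℂ (TorusRing N)).injective

lemma euler_euler_prod (v : Fin N → ℤ) (j : Fin N) :
    euler j (euler j (∏ i, sinPow i (v i))) =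
      (v j ^ 2 : TorusRing N) * ∏ i, sinPow i (v i) := by
  have hz : euler j (∏ i ∈ Finset.univ.erase j, sinPow i (v i)) = 0 := by
    have h0 := two_mul_derivation_prod (euler j) (Finset.univ.erase j)
      (fun i => sinPow i (v i)) (fun _ => 0) (fun i hi => by
        rw [euler_sinPow, if_neg (Finset.ne_of_mem_erase hi).symm, mul_zero, mul_zero])
    rw [Finset.sum_const_zero, mul_zero] at h0
    exact (mul_eq_zero.1 h0).resolve_left two_ne_zero
  rw [← Finset.mul_prod_erase _ _ (Finset.mem_univ j)]
  simp only [Derivation.leibniz, hz, euler_sinPow, euler_cosPow, if_true, smul_eq_mul,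
    Derivation.map_intCast, mul_zero, zero_add, add_zero]
  ring

lemma torusLaplacian_altDet (v : Fin N → ℤ) :
    torusLaplacian (altDet v) = (normSq v : ℂ) • altDet v := by
  simp only [altDet, Matrix.det_apply', torusLaplacian, Matrix.of_apply]
  simp only [map_sum, Derivation.leibniz, Derivation.map_intCast, smul_eq_mul, mul_zero, add_zero]
  rw [Finset.sum_comm, Finset.smul_sum]
  refine Finset.sum_congr rfl fun σ _ => ?_
  simp only [euler_euler_prod fun i => v (σ i)]
  rw [Equiv.sum_comp σ fun i => _ * (((v i : ℤ) : TorusRing N) ^ 2 * _),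
    ← algebraMap_smul (TorusRing N) (normSq v : ℂ), map_intCast, smul_eq_mul, normSq,
    ← Finset.mul_sum, ← Finset.sum_mul]
  push_cast
  ring

/-- The multiplicity of the Weyl denominator in an alternating sum. -/
def weylCoeff (v : Fin N → ℤ) : ℤ :=
  (Matrix.of fun i r : Fin N => (if v i = rho N r then 1 else 0) -
    (if v i = -rho N r then 1 else 0) : Matrix (Fin N) (Fin N) ℤ).det

lemma altDet_eq_of_abs_le (v : Fin N → ℤ) (hv : ∀ i, |v i| ≤ N) :
    altDet v = (weylCoeff v : TorusRing N) * weylDenom N := by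
  have h : (Matrix.of fun i j => sinPow j (v i) : Matrix (Fin N) (Fin N) (TorusRing N)) =
      ((Matrix.of fun i r : Fin N => (if v i = rho N r then 1 else 0) -
        (if v i = -rho N r then 1 else 0) : Matrix (Fin N) (Fin N) ℤ).map
          (Int.castRingHom (TorusRing N))) * Matrix.of fun i j => sinPow j (rho N i) := by
    ext1 i j
    simp only [Matrix.mul_apply, Matrix.of_apply, Matrix.map_apply, map_sub, sub_mul,
      Finset.sum_sub_distrib]
    simp only [apply_ite (Int.castRingHom (TorusRing N)), map_one, map_zero, ite_mul, one_mul,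
      zero_mul]
    have hi := abs_le.1 (hv i)
    rcases lt_trichotomy (v i) 0 with h0 | h0 | h0
    · have e : -v i = rho N ⟨(-v i - 1).toNat, by omega⟩ := by simp only [rho]; omega
      rw [Finset.sum_eq_zero fun r _ => if_neg (by simp only [rho]; omega),
        Finset.sum_eq_single_of_mem ⟨(-v i - 1).toNat, by omega⟩ (Finset.mem_univ _)]
      · rw [if_pos (by rw [← e, neg_neg]), ← e, sinPow_neg]; ring
      · intro b _ hb
        refine if_neg fun hc => hb ?_
        ext
        simp only [rho] at hc ⊢
        omega
    · rw [Finset.sum_eq_zero fun r _ => if_neg (by simp only [rho]; omega),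
        Finset.sum_eq_zero fun r _ => if_neg (by simp only [rho]; omega), h0, sinPow_zero,
        sub_zero]
    · have e : v i = rho N ⟨(v i - 1).toNat, by omega⟩ := by simp only [rho]; omega
      rw [Finset.sum_eq_zero (f := fun r => if v i = -rho N r then _ else _)
        fun r _ => if_neg (by simp only [rho]; omega),
        Finset.sum_eq_single_of_mem ⟨(v i - 1).toNat, by omega⟩ (Finset.mem_univ _)]
      · rw [if_pos e, ← e, sub_zero]
      · intro b _ hb
        refine if_neg fun hc => hb ?_
        ext
        simp only [rho] at hc ⊢
        omega
  rw [altDet, h, Matrix.det_mul, ← RingHom.mapMatrix_apply, ← RingHom.map_det]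
  rfl

lemma sum_sq_le_sum_sq (n : ℕ) : ∀ s : Finset ℕ, s.card = n → (∀ x ∈ s, 1 ≤ x) →
    ∑ i ∈ Finset.range n, (i + 1) ^ 2 ≤ ∑ x ∈ s, x ^ 2 ∧
      (∑ i ∈ Finset.range n, (i + 1) ^ 2 = ∑ x ∈ s, x ^ 2 → ∀ x ∈ s, x ≤ n) := by
  induction n with
  | zero =>
    intro s hs _
    simp [Finset.card_eq_zero.1 hs]
  | succ n ih =>
    intro s hs h1
    have hne : s.Nonempty := Finset.card_pos.1 (by omega)
    have hmem := s.max'_mem hne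
    have hmax : ∀ x ∈ s, x ≤ s.max' hne := fun x hx => s.le_max' x hx
    generalize s.max' hne = M at hmem hmax
    have hM : n + 1 ≤ M := by
      have hsub : s ⊆ Finset.Icc 1 M := fun x hx => Finset.mem_Icc.2 ⟨h1 x hx, hmax x hx⟩
      simpa [hs] using Finset.card_le_card hsub
    have hih := (ih (s.erase M) (by rw [Finset.card_erase_of_mem hmem, hs]; rfl)
      fun x hx => h1 x (Finset.mem_of_mem_erase hx)).1
    rw [Finset.sum_range_succ, ← Finset.add_sum_erase s (fun x => x ^ 2) hmem]
    have hsq : (n + 1) ^ 2 ≤ M ^ 2 := Nat.pow_le_pow_left hM 2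
    refine ⟨by omega, fun heq x hx => (hmax x hx).trans ?_⟩
    exact le_of_not_gt fun hlt => by
      have : (n + 1) ^ 2 < M ^ 2 := Nat.pow_lt_pow_left hlt two_ne_zero
      omega

lemma abs_le_of_normSq_eq (v : Fin N → ℤ) (hinj : Function.Injective fun i => |v i|)
    (h0 : ∀ i, v i ≠ 0) (hv : normSq v = normSq (rho N)) (i : Fin N) : |v i| ≤ N := by
  have hinj' : Function.Injective fun i => (v i).natAbs := fun a b hab => hinj (by
    simp only at hab ⊢
    rw [Int.abs_eq_natAbs, Int.abs_eq_natAbs, hab])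
  have h := (sum_sq_le_sum_sq N (Finset.univ.image fun i => (v i).natAbs)
    (by rw [Finset.card_image_of_injective _ hinj', Finset.card_univ, Fintype.card_fin])
    (by simp only [Finset.mem_image, Finset.mem_univ, true_and, forall_exists_index]
        rintro x j rfl
        have := h0 j
        omega)).2 (by
      rw [Finset.sum_image fun a _ b _ hab => hinj' hab, Finset.sum_range]
      zify
      simpa [normSq, rho] using hv.symm) _ (Finset.mem_image_of_mem _ (Finset.mem_univ i))
  have hi : (v i).natAbs ≤ N := h
  rw [Int.abs_eq_natAbs]
  exact_mod_cast hi

lemma altDet_eq_zero_of_abs_eq (v : Fin N → ℤ) {i j : Fin N} (hij : i ≠ j)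
    (h : |v i| = |v j|) : altDet v = 0 := by
  rcases abs_eq_abs.1 h with h | h
  · exact Matrix.det_zero_of_row_eq hij (by ext1 r; simp [h])
  · rw [altDet, ← Matrix.det_updateRow_add_self _ hij]
    exact Matrix.det_eq_zero_of_row_eq_zero i fun r => by simp [h, sinPow_neg]

lemma altDet_eq_zero_of_eq_zero (v : Fin N → ℤ) {i : Fin N} (h : v i = 0) : altDet v = 0 :=
  Matrix.det_eq_zero_of_row_eq_zero i fun r => by simp [h, sinPow_zero]

/-- Evaluation of a Laurent polynomial at a point of the complex torus. -/
def evalTorus (z : Fin N → ℂˣ) : TorusRing N →ₐ[ℂ] ℂ :=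
  AddMonoidAlgebra.lift ℂ _ _
    { toFun := fun v => ((∏ i, z i ^ (v.toAdd i) : ℂˣ) : ℂ)
      map_one' := by simp
      map_mul' := fun v w => by
        simp only [toAdd_mul, Pi.add_apply, _root_.zpow_add, Finset.prod_mul_distrib, Units.val_mul] }

lemma evalTorus_coordPow (z : Fin N → ℂˣ) (j : Fin N) (m : ℤ) :
    evalTorus z (coordPow j m) = (z j : ℂ) ^ m := by
  simp only [evalTorus, coordPow, AddMonoidAlgebra.lift_single, MonoidHom.coe_mk, OneHom.coe_mk,
    one_smul, toAdd_ofAdd]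
  rw [Finset.prod_eq_single j, Pi.single_eq_same, Units.val_zpow_eq_zpow_val]
  · intro i _ hi
    rw [Pi.single_eq_of_ne hi, zpow_zero]
  · simp

lemma weylDenom_ne_zero : weylDenom N ≠ 0 := by
  rw [weylDenom_eq_prod]
  refine mul_ne_zero (Finset.prod_ne_zero_iff.2 fun j _ h => ?_)
    (Finset.prod_ne_zero_iff.2 fun i _ => Finset.prod_ne_zero_iff.2 fun j hj h => ?_)
  · have := congrArg (evalTorus fun _ => Units.mk0 2 two_ne_zero) h
    simp [sinPow, evalTorus_coordPow] at this
    norm_num at this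
  · have hij : i ≠ j := (Finset.mem_Ioi.1 hj).ne
    have := congrArg (evalTorus (Pi.mulSingle i (Units.mk0 2 two_ne_zero))) h
    simp [cosPow, evalTorus_coordPow, hij.symm] at this
    norm_num at this

lemma weylCoeff_eq_zero_of_lt_abs (v : Fin N → ℤ) {i : Fin N} (h : (N : ℤ) < |v i|) :
    weylCoeff v = 0 := by
  refine Matrix.det_eq_zero_of_row_eq_zero i fun r => ?_
  have := r.2
  rw [lt_abs] at h
  rw [Matrix.of_apply, if_neg (by simp only [rho]; omega), if_neg (by simp only [rho]; omega),
    sub_zero]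

lemma altDet_of_normSq_eq (v : Fin N → ℤ) (hv : normSq v = normSq (rho N)) :
    altDet v = (weylCoeff v : TorusRing N) * weylDenom N := by
  by_cases hN : ∀ i, |v i| ≤ N
  · exact altDet_eq_of_abs_le v hN
  · have h : altDet v = 0 := by
      by_cases h0 : ∀ i, v i ≠ 0
      · by_cases hinj : Function.Injective fun i => |v i|
        · exact absurd (abs_le_of_normSq_eq v hinj h0 hv) hN
        · simp only [Function.Injective, not_forall] at hinj
          obtain ⟨i, j, hij, hne⟩ := hinj
          exact altDet_eq_zero_of_abs_eq v hne hij
      · push Not at h0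
        obtain ⟨i, hi⟩ := h0
        exact altDet_eq_zero_of_eq_zero v hi
    push Not at hN
    obtain ⟨i, hi⟩ := hN
    rw [h, weylCoeff_eq_zero_of_lt_abs v hi, Int.cast_zero, zero_mul]

lemma weylCoeff_eq_zero_of_normSq_ne (v : Fin N → ℤ) (hv : normSq v ≠ normSq (rho N)) :
    weylCoeff v = 0 := by
  by_cases hN : ∀ i, |v i| ≤ N
  · have h1 := altDet_eq_of_abs_le v hN
    have h2 : altDet v = (weylCoeff v : ℂ) • weylDenom N := by
      rw [h1, ← algebraMap_smul (TorusRing N) (weylCoeff v : ℂ), map_intCast, smul_eq_mul]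
    have h3 := torusLaplacian_altDet v
    have h4 : torusLaplacian (altDet v) = (weylCoeff v : ℂ) • torusLaplacian (weylDenom N) := by
      simp only [h2, torusLaplacian, Derivation.map_smul, Finset.smul_sum]
    rw [h4, weylDenom, torusLaplacian_altDet, ← weylDenom, h2, smul_smul, smul_smul, ← sub_eq_zero,
      ← sub_smul, smul_eq_zero, or_iff_left weylDenom_ne_zero] at h3
    have h5 : weylCoeff v * normSq (rho N) - normSq v * weylCoeff v = 0 := by exact_mod_cast h3
    have h6 : weylCoeff v * (normSq (rho N) - normSq v) = 0 := by linear_combination h5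
    exact (mul_eq_zero.1 h6).resolve_right (sub_ne_zero.2 hv.symm)
  · push Not at hN
    obtain ⟨i, hi⟩ := hN
    exact weylCoeff_eq_zero_of_lt_abs v hi

/-- A linear functional on trace polynomials vanishing on the range of the Schwinger–Dyson
operators is given by the Weyl integration formula. -/
theorem functional_eq_sum_weylCoeff (E : TracePoly →ₗ[ℂ] ℂ)
    (hSD : ∀ k h, E (schwingerDyson k h) = 0)
    (hconst : ∀ f c, toTorus N f = algebraMap ℂ _ c → E f = c)
    {ι : Type*} (s : Finset ι) (v : ι → Fin N → ℤ) (f : TracePoly)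
    (hf : weylDenom N * toTorus N f = ∑ t ∈ s, altDet (v t)) :
    E f = ∑ t ∈ s, (weylCoeff (v t) : ℂ) := by
  have key : ∀ S : Finset ℤ, 0 ∉ S → ∃ g : TracePoly, E g = E f ∧
      weylDenom N * toTorus N g = ∑ t ∈ s,
        (∏ a ∈ S, (1 - (normSq (v t) - normSq (rho N) : ℂ) / a)) • altDet (v t) := by
    intro S
    induction S using Finset.induction_on with
    | empty => exact fun _ => ⟨f, rfl, by simpa using hf⟩
    | insert a S ha ih =>
      intro h0
      obtain ⟨g, hg1, hg2⟩ := ih fun h => h0 (Finset.mem_insert_of_mem h)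
      obtain ⟨g', hg'1, hg'2⟩ := exists_laplacian_lift (N := N) g
      refine ⟨g - (a : ℂ)⁻¹ • g', by rw [map_sub, map_smul, hg'1 E hSD, hg1]; simp, ?_⟩
      have hL : ∀ (c : ι → ℂ), torusLaplacian (∑ t ∈ s, c t • altDet (v t)) =
          ∑ t ∈ s, (normSq (v t) : ℂ) • c t • altDet (v t) := by
        intro c
        have := fun t => torusLaplacian_altDet (v t)
        simp only [torusLaplacian] at this ⊢
        simp only [map_sum, Derivation.map_smul]
        rw [Finset.sum_comm]
        refine Finset.sum_congr rfl fun t _ => ?_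
        rw [← Finset.smul_sum, this, smul_comm]
      rw [map_sub, map_smul, mul_sub, mul_smul_comm, hg'2, hg2, hL, weylDenom,
        torusLaplacian_altDet, ← weylDenom, smul_mul_assoc, hg2, Finset.smul_sum,
        ← Finset.sum_sub_distrib, Finset.smul_sum, ← Finset.sum_sub_distrib]
      refine Finset.sum_congr rfl fun t _ => ?_
      rw [Finset.prod_insert ha]
      module
  obtain ⟨g, hg1, hg2⟩ := key ((s.image fun t => normSq (v t) - normSq (rho N)).erase 0)
    (Finset.notMem_erase _ _)
  rw [← hg1]
  refine hconst g _ (mul_left_cancel₀ weylDenom_ne_zero ?_)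
  rw [hg2, map_sum, Finset.mul_sum]
  refine Finset.sum_congr rfl fun t ht => ?_
  rw [map_intCast]
  by_cases h : normSq (v t) = normSq (rho N)
  · rw [altDet_of_normSq_eq _ h, h, mul_comm]
    simp
  · have hz : (normSq (v t) - normSq (rho N) : ℂ) ≠ 0 := by
      exact_mod_cast sub_ne_zero.2 h
    rw [weylCoeff_eq_zero_of_normSq_ne _ h,
      Finset.prod_eq_zero (i := normSq (v t) - normSq (rho N))]
    · simp
    · exact Finset.mem_erase.2 ⟨sub_ne_zero.2 h, Finset.mem_image_of_mem _ ht⟩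
    · push_cast
      rw [div_self hz, sub_self]

lemma cosPow_mul_prod (k : ℤ) (w : Fin N → ℤ) (j : Fin N) :
    cosPow j k * ∏ i, sinPow i (w i) =
      ∏ i, sinPow i (Function.update w j (w j + k) i) +
        ∏ i, sinPow i (Function.update w j (w j - k) i) := by
  have h : ∀ m, ∏ i, sinPow i (Function.update w j m i) =
      sinPow j m * ∏ i ∈ Finset.univ.erase j, sinPow i (w i) := by
    intro m
    rw [← Finset.mul_prod_erase _ _ (Finset.mem_univ j), Function.update_self]
    congr 1
    exact Finset.prod_congr rfl fun i hi => by
      rw [Function.update_of_ne (Finset.ne_of_mem_erase hi)]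
  rw [h, h, ← add_mul, ← sinPow_mul_cosPow, ← Finset.mul_prod_erase _ _ (Finset.mem_univ j)]
  ring

lemma powerSum_mul_altDet (k : ℤ) (v : Fin N → ℤ) :
    powerSum N k * altDet v = ∑ i, (altDet (Function.update v i (v i + k)) +
      altDet (Function.update v i (v i - k))) := by
  simp only [altDet, Matrix.det_apply', Matrix.of_apply, powerSum, ← Finset.sum_add_distrib]
  rw [Finset.sum_comm, Finset.mul_sum]
  refine Finset.sum_congr rfl fun σ _ => ?_
  rw [← Equiv.sum_comp σ fun i => _ * _ + _ * _, Finset.sum_mul]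
  refine Finset.sum_congr rfl fun j _ => ?_
  have h : ∀ m i, Function.update v (σ j) m (σ i) = Function.update (fun i => v (σ i)) j m i := by
    intro m i
    simp only [Function.update_apply, σ.injective.eq_iff]
  simp only [h]
  rw [← mul_add, ← cosPow_mul_prod k (fun i => v (σ i)) j]
  ring

/-- The coordinates of `sinPow _ m` in the basis `sinPow _ (rho N r)`. -/
def sinCoord (N : ℕ) (m : ℤ) (r : Fin N) : ℤ :=
  (if m = rho N r then 1 else 0) - (if m = -rho N r then 1 else 0)

lemma of_update_sinCoord (v : Fin N → ℤ) (i : Fin N) (m : ℤ) :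
    (Matrix.of fun a => sinCoord N (Function.update v i m a)) =
      (Matrix.of fun i => sinCoord N (v i)).updateRow i (sinCoord N m) := by
  ext a b
  rw [Matrix.updateRow_apply, Matrix.of_apply]
  by_cases h : a = i
  · subst h; simp
  · simp [h]

lemma weylCoeff_update (v : Fin N → ℤ) (i : Fin N) (m : ℤ) :
    weylCoeff (Function.update v i m) =
      ((Matrix.of fun i => sinCoord N (v i)).updateRow i (sinCoord N m)).det := by
  rw [← of_update_sinCoord]
  rfl

/-- The action of multiplication by `cosPow _ k` on `sinCoord`. -/
def stepRow (N : ℕ) (k m : ℤ) : Fin N → ℤ := sinCoord N (m + k) + sinCoord N (m - k)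

lemma weylCoeff_update_add (k : ℤ) (v : Fin N → ℤ) (i : Fin N) :
    weylCoeff (Function.update v i (v i + k)) + weylCoeff (Function.update v i (v i - k)) =
      ((Matrix.of fun i => sinCoord N (v i)).updateRow i (stepRow N k (v i))).det := by
  rw [weylCoeff_update, weylCoeff_update, stepRow, Matrix.det_updateRow_add]

lemma of_sinCoord_rho : (Matrix.of fun i => sinCoord N (rho N i)) = 1 := by
  ext i j
  simp only [Matrix.of_apply, sinCoord, rho, Matrix.one_apply, Fin.ext_iff]
  split_ifs <;> omega

lemma det_updateRow_one (i : Fin N) (u : Fin N → ℤ) :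
    ((1 : Matrix (Fin N) (Fin N) ℤ).updateRow i u).det = u i := by
  rw [← Matrix.det_transpose, ← Matrix.updateCol_transpose, Matrix.transpose_one,
    ← Matrix.cramer_apply, Matrix.cramer_one]
  rfl

lemma det_updateRow_updateRow_one {i j : Fin N} (hij : i ≠ j) (u w : Fin N → ℤ) :
    (((1 : Matrix (Fin N) (Fin N) ℤ).updateRow i u).updateRow j w).det =
      u i * w j - u j * w i := by
  have h : ((1 : Matrix (Fin N) (Fin N) ℤ).updateRow i u).updateRow j w =
      1 + (Matrix.of fun a => ![if a = i then 1 else 0, if a = j then 1 else 0] :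
          Matrix (Fin N) (Fin 2) ℤ) *
        (Matrix.of ![u - Pi.single i 1, w - Pi.single j 1] : Matrix (Fin 2) (Fin N) ℤ) := by
    ext a b
    rw [Matrix.updateRow_apply, Matrix.updateRow_apply, Matrix.add_apply, Matrix.mul_apply,
      Fin.sum_univ_two]
    by_cases hj : a = j
    · subst hj
      simp [hij.symm, Matrix.one_apply, Pi.single_apply, eq_comm (a := b)]
    · by_cases hi : a = i
      · subst hi
        simp [hij, Matrix.one_apply, Pi.single_apply, eq_comm (a := b)]
      · simp [hi, hj]
  rw [h, Matrix.det_one_add_mul_comm, Matrix.det_fin_two]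
  simp [Matrix.vecMul, dotProduct, hij, hij.symm, Pi.single_apply]

lemma sum_fin_rho (g : ℤ → ℤ) : ∑ i : Fin N, g (rho N i) = ∑ m ∈ Finset.Icc (1 : ℤ) N, g m := by
  refine Finset.sum_bij (fun i _ => rho N i) ?_ ?_ ?_ ?_
  · intro i _
    simp only [rho, Finset.mem_Icc]; omega
  · intro i _ j _ h
    simp only [rho] at h
    ext; omega
  · intro m hm
    rw [Finset.mem_Icc] at hm
    exact ⟨⟨(m - 1).toNat, by omega⟩, Finset.mem_univ _, by simp only [rho]; omega⟩
  · simp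

/-- The weights occurring in the product of a power sum and an alternating sum. -/
def shiftWeight (k : ℤ) (v : Fin N → ℤ) (p : Fin N × Bool) : Fin N → ℤ :=
  Function.update v p.1 (if p.2 then v p.1 + k else v p.1 - k)

lemma powerSum_mul_altDet_eq_sum_shiftWeight (k : ℤ) (v : Fin N → ℤ) :
    powerSum N k * altDet v = ∑ p, altDet (shiftWeight k v p) := by
  rw [powerSum_mul_altDet, Fintype.sum_prod_type]
  simp [shiftWeight]

lemma sum_weylCoeff_shiftWeight (k : ℤ) (v : Fin N → ℤ) :
    ∑ p, weylCoeff (shiftWeight k v p) =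
      ∑ i, ((Matrix.of fun i => sinCoord N (v i)).updateRow i (stepRow N k (v i))).det := by
  rw [Fintype.sum_prod_type]
  simp [shiftWeight, weylCoeff_update_add]

lemma sinCoord_add_self (k : ℤ) (i j : Fin N) : stepRow N k (rho N i) j =
    (if rho N j = rho N i + k then 1 else 0) + (if rho N j = rho N i - k then 1 else 0) -
      (if rho N i + rho N j = k then 1 else 0) - (if rho N i + rho N j = -k then 1 else 0) := by
  simp only [stepRow, sinCoord, Pi.add_apply]
  split_ifs <;> omega

lemma sum_sum_weylCoeff_shiftWeight (k : ℤ) (hk : 1 ≤ k) :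
    ∑ p, ∑ q, weylCoeff (shiftWeight k (shiftWeight k (rho N) p) q) =
      ∑ i, (2 - if rho N i = k then 1 else 0) + (∑ i, stepRow N k (rho N i) i) ^ 2 -
        ∑ i, ∑ j, stepRow N k (rho N i) j * stepRow N k (rho N j) i := by
  have h1 : ∀ i m, ∑ j, ((Matrix.of fun a => sinCoord N (Function.update (rho N) i m a)).updateRow
      j (stepRow N k (Function.update (rho N) i m j))).det = stepRow N k m i +
        ∑ j, (sinCoord N m i * stepRow N k (rho N j) j - sinCoord N m j * stepRow N k (rho N j) i) := by
    intro i m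
    rw [← Finset.add_sum_erase _ _ (Finset.mem_univ i), of_update_sinCoord, of_sinCoord_rho,
      Function.update_self, Matrix.updateRow_idem, det_updateRow_one,
      ← Finset.add_sum_erase _ _ (Finset.mem_univ i), sub_self, zero_add]
    congr 1
    refine Finset.sum_congr rfl fun j hj => ?_
    have hij := Finset.ne_of_mem_erase hj
    rw [Function.update_of_ne hij, det_updateRow_updateRow_one hij.symm]
  simp only [sum_weylCoeff_shiftWeight]
  rw [Fintype.sum_prod_type]
  simp only [shiftWeight, Fintype.sum_bool, if_true, Bool.false_eq_true, if_false, h1]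
  have h2 : ∀ i : Fin N, stepRow N k (rho N i + k) i + stepRow N k (rho N i - k) i =
      2 - if rho N i = k then 1 else 0 := by
    intro i
    have : 1 ≤ rho N i := by simp only [rho]; omega
    simp only [stepRow, sinCoord, Pi.add_apply]
    split_ifs <;> omega
  rw [sq, Finset.sum_mul_sum, ← Finset.sum_add_distrib, ← Finset.sum_sub_distrib]
  refine Finset.sum_congr rfl fun i _ => ?_
  rw [← h2, add_add_add_comm, add_sub_assoc, ← Finset.sum_add_distrib, ← Finset.sum_sub_distrib]
  congr 1
  refine Finset.sum_congr rfl fun j _ => ?_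
  have h3 : ∀ a, stepRow N k (rho N i) a = sinCoord N (rho N i + k) a + sinCoord N (rho N i - k) a :=
    fun _ => rfl
  rw [h3, h3]
  ring

lemma sum_sum_weylCoeff_shiftWeight_eq (k : ℤ) (hk : 1 ≤ k) :
    ∑ p, ∑ q, weylCoeff (shiftWeight k (shiftWeight k (rho N) p) q) =
      min k (2 * N) + (if Even k ∧ k ≤ 2 * N then 1 else 0) + (if k ≤ N then 1 else 0) -
        (if k ≤ 2 * N then 1 else 0) := by
  have h1 : ∑ i : Fin N, (2 - if rho N i = k then 1 else 0 : ℤ) = 2 * N - if k ≤ N then 1 else 0 := by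
    rw [Finset.sum_sub_distrib, sum_fin_rho fun m => if m = k then 1 else 0, Finset.sum_ite_eq']
    simp [hk, mul_comm]
  have h2 : ∑ i, stepRow N k (rho N i) i = - if Even k ∧ k ≤ 2 * N then 1 else 0 := by
    have : ∀ i, stepRow N k (rho N i) i = - if 2 * rho N i = k then 1 else 0 := by
      intro i
      have : 1 ≤ rho N i := by simp only [rho]; omega
      rw [sinCoord_add_self]
      split_ifs <;> omega
    simp only [this, Finset.sum_neg_distrib]
    rw [sum_fin_rho fun m => if 2 * m = k then 1 else 0]
    congr 1
    split_ifs with h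
    · obtain ⟨⟨r, hr⟩, h⟩ := h
      rw [Finset.sum_eq_single_of_mem r (Finset.mem_Icc.2 ⟨by omega, by omega⟩), if_pos (by omega)]
      intro b _ hb
      exact if_neg (by omega)
    · refine Finset.sum_eq_zero fun m hm => if_neg fun hmk => h ⟨⟨m, by omega⟩, ?_⟩
      have := (Finset.mem_Icc.1 hm).2
      omega
  have h3 : ∑ i, ∑ j, stepRow N k (rho N i) j * stepRow N k (rho N j) i =
      2 * max (N - k) 0 + max (min (N : ℤ) (k - 1) - max 1 (k - N) + 1) 0 := by
    have e : ∀ i j, stepRow N k (rho N i) j * stepRow N k (rho N j) i =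
        (if rho N j = rho N i + k then 1 else 0) + (if rho N j = rho N i - k then 1 else 0) +
          (if rho N j = k - rho N i then 1 else 0) := by
      intro i j
      have : 1 ≤ rho N i := by simp only [rho]; omega
      have : 1 ≤ rho N j := by simp only [rho]; omega
      rw [sinCoord_add_self, sinCoord_add_self]
      split_ifs <;> omega
    have e1 : ∀ a b : ℤ, 1 ≤ a → b ≤ N → ∑ i : Fin N, (if a ≤ rho N i ∧ rho N i ≤ b then 1 else 0) =
        max (b - a + 1) 0 := by
      intro a b ha hb
      rw [sum_fin_rho fun m => if a ≤ m ∧ m ≤ b then 1 else 0, Finset.sum_boole]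
      have : (Finset.Icc (1 : ℤ) N).filter (fun m => a ≤ m ∧ m ≤ b) = Finset.Icc a b := by
        ext; simp only [Finset.mem_filter, Finset.mem_Icc]; omega
      rw [this, Int.card_Icc]
      simp; ring_nf
    have e2 : ∀ m : ℤ, ∑ j : Fin N, (if rho N j = m then 1 else 0 : ℤ) =
        if 1 ≤ m ∧ m ≤ N then 1 else 0 := by
      intro m
      rw [sum_fin_rho fun l => if l = m then 1 else 0, Finset.sum_ite_eq']
      simp
    simp only [e, Finset.sum_add_distrib, e2]
    have e3 : ∀ i : Fin N, (if 1 ≤ rho N i + k ∧ rho N i + k ≤ N then 1 else 0 : ℤ) =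
        if 1 ≤ rho N i ∧ rho N i ≤ N - k then 1 else 0 := by
      intro i
      have : 1 ≤ rho N i := by simp only [rho]; omega
      split_ifs <;> omega
    have e4 : ∀ i : Fin N, (if 1 ≤ rho N i - k ∧ rho N i - k ≤ N then 1 else 0 : ℤ) =
        if k + 1 ≤ rho N i ∧ rho N i ≤ N then 1 else 0 := by
      intro i
      have : rho N i ≤ N := by simp only [rho]; omega
      split_ifs <;> omega
    have e5 : ∀ i : Fin N, (if 1 ≤ k - rho N i ∧ k - rho N i ≤ N then 1 else 0 : ℤ) =
        if max 1 (k - N) ≤ rho N i ∧ rho N i ≤ min (N : ℤ) (k - 1) then 1 else 0 := by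
      intro i
      have : rho N i ≤ N := by simp only [rho]; omega
      have : 1 ≤ rho N i := by simp only [rho]; omega
      split_ifs <;> omega
    simp only [e3, e4, e5]
    rw [e1 _ _ le_rfl (by omega), e1 _ _ (by omega) le_rfl, e1 _ _ (by omega) (by omega)]
    omega
  rw [sum_sum_weylCoeff_shiftWeight k hk, h1, h2, h3, neg_sq]
  split_ifs <;> omega

/-- The second moment of the `k`-th trace. -/
theorem functional_X_sq (E : TracePoly →ₗ[ℂ] ℂ)
    (hSD : ∀ k h, E (schwingerDyson k h) = 0)
    (hconst : ∀ f c, toTorus N f = algebraMap ℂ _ c → E f = c) (k : ℕ) (hk : 1 ≤ k) :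
    E (MvPolynomial.X k ^ 2) = ((min (k : ℤ) (2 * N) + (if Even (k : ℤ) ∧ (k : ℤ) ≤ 2 * N then 1
      else 0) + (if (k : ℤ) ≤ N then 1 else 0) - (if (k : ℤ) ≤ 2 * N then 1 else 0) : ℤ) : ℂ) := by
  rw [← sum_sum_weylCoeff_shiftWeight_eq (k : ℤ) (by exact_mod_cast hk), ← Fintype.sum_prod_type']
  push_cast
  refine functional_eq_sum_weylCoeff E hSD hconst Finset.univ _ _ ?_
  rw [map_pow, toTorus_X, sq, ← mul_assoc, mul_comm (weylDenom N), mul_comm, weylDenom,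
    powerSum_mul_altDet_eq_sum_shiftWeight, Finset.mul_sum,
    Fintype.sum_prod_type (γ := TorusRing N) (α₁ := Fin N × Bool)]
  simp only [powerSum_mul_altDet_eq_sum_shiftWeight]

/-- Square complex matrices of size `2N`. -/
abbrev Mat (N : ℕ) : Type := Matrix (Fin (2 * N)) (Fin (2 * N)) ℂ

instance : BorelSpace (Mat N) :=
  inferInstanceAs (BorelSpace (Fin (2 * N) → Fin (2 * N) → ℂ))

lemma J_transpose : (J N)ᵀ = -J N := by
  ext i j
  simp only [_root_.J, Matrix.transpose_apply, Matrix.of_apply, Matrix.neg_apply]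
  have := i.2
  split_ifs <;> first | omega | simp

lemma J_conjTranspose : (J N)ᴴ = -J N := by
  rw [← J_transpose]
  ext i j
  simp only [_root_.J, Matrix.conjTranspose_apply, Matrix.transpose_apply, Matrix.of_apply]
  split_ifs <;> simp

lemma J_mul_J : J N * J N = -1 := by
  ext i j
  rw [Matrix.mul_apply, Matrix.neg_apply, Matrix.one_apply]
  have hi := i.2
  by_cases h : (i : ℕ) < N
  · rw [Finset.sum_eq_single_of_mem ⟨i + N, by omega⟩ (Finset.mem_univ _)]
    · simp only [_root_.J, Matrix.of_apply, Fin.ext_iff, if_true, one_mul]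
      split_ifs <;> first | omega | simp
    · intro b _ hb
      simp only [ne_eq, Fin.ext_iff] at hb
      simp only [_root_.J, Matrix.of_apply]
      rw [if_neg (by omega), if_neg (by omega), zero_mul]
  · rw [Finset.sum_eq_single_of_mem ⟨i - N, by omega⟩ (Finset.mem_univ _)]
    · simp only [_root_.J, Matrix.of_apply, Fin.ext_iff]
      split_ifs <;> first | omega | simp
    · intro b _ hb
      simp only [ne_eq, Fin.ext_iff] at hb
      simp only [_root_.J, Matrix.of_apply]
      rw [if_neg (by omega), if_neg (by omega), zero_mul]

lemma transpose_mul_J {A : Mat N} (hA : A ∈ USp N) : Aᵀ * J N = J N * Aᴴ := by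
  have h : A * Aᴴ = 1 := Matrix.mem_unitaryGroup_iff.1 hA.1
  conv_rhs => rw [← hA.2]
  rw [Matrix.mul_assoc, Matrix.mul_assoc, h, Matrix.mul_one]

lemma transpose_pow_mul_J {A : Mat N} (hA : A ∈ USp N) (m : ℕ) :
    (A ^ m)ᵀ * J N = J N * Aᴴ ^ m := by
  induction m with
  | zero => simp
  | succ m ih =>
    rw [pow_succ, Matrix.transpose_mul, Matrix.mul_assoc, ih, ← Matrix.mul_assoc,
      transpose_mul_J hA, Matrix.mul_assoc, ← pow_succ']

lemma conjTranspose_pow_eq {A : Mat N} (hA : A ∈ USp N) (m : ℕ) :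
    Aᴴ ^ m = -(J N * (A ^ m)ᵀ * J N) := by
  rw [Matrix.mul_assoc, transpose_pow_mul_J hA, ← Matrix.mul_assoc, J_mul_J]
  simp

lemma trace_conjTranspose_pow {A : Mat N} (hA : A ∈ USp N) (m : ℕ) :
    (Aᴴ ^ m).trace = (A ^ m).trace := by
  rw [conjTranspose_pow_eq hA, Matrix.trace_neg, Matrix.trace_mul_comm, ← Matrix.mul_assoc,
    J_mul_J, Matrix.neg_mul, Matrix.one_mul, Matrix.trace_neg, neg_neg, Matrix.trace_transpose]

lemma trace_conjTranspose_pow_mul_pow {A : Mat N} (hA : A ∈ USp N) (m n : ℕ) :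
    (Aᴴ ^ m * A ^ n).trace = (A ^ ((n : ℤ) - m).natAbs).trace := by
  have h : Aᴴ * A = 1 := Matrix.mem_unitaryGroup_iff'.1 hA.1
  have hc : Commute Aᴴ A := by
    rw [Commute, SemiconjBy, h]; exact (Matrix.mem_unitaryGroup_iff.1 hA.1).symm
  rcases le_total m n with hmn | hmn
  · obtain ⟨d, rfl⟩ := Nat.exists_eq_add_of_le hmn
    rw [pow_add, ← Matrix.mul_assoc, ← hc.mul_pow, h, one_pow, Matrix.one_mul]
    congr 2
    omega
  · obtain ⟨d, rfl⟩ := Nat.exists_eq_add_of_le hmn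
    rw [add_comm n d, pow_add, Matrix.mul_assoc, ← hc.mul_pow, h, one_pow, Matrix.mul_one,
      trace_conjTranspose_pow hA]
    congr 2
    omega

lemma isClosed_USp : IsClosed (USp N) := by
  have : USp N = {A : Mat N | A * Aᴴ = 1} ∩ {A | Aᵀ * J N * A = J N} := by
    ext A
    simp only [USp, Set.mem_ofPred_eq, Set.mem_inter_iff, Matrix.mem_unitaryGroup_iff,
      Matrix.star_eq_conjTranspose]
  rw [this]
  refine (isClosed_eq ?_ continuous_const).inter (isClosed_eq ?_ continuous_const)
  · exact continuous_id.matrix_mul continuous_id.matrix_conjTranspose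
  · exact (continuous_id.matrix_transpose.matrix_mul continuous_const).matrix_mul continuous_id

lemma isCompact_USp : IsCompact (USp N) := by
  have hK : IsCompact (Set.pi Set.univ fun _ : Fin (2 * N) =>
      Set.pi Set.univ fun _ : Fin (2 * N) => Metric.closedBall (0 : ℂ) 1) :=
    isCompact_univ_pi fun _ => isCompact_univ_pi fun _ => isCompact_closedBall _ _
  refine IsCompact.of_isClosed_subset (X := Mat N) hK isClosed_USp fun A hA i _ j _ => ?_
  rw [mem_closedBall_zero_iff]
  exact entry_norm_bound_of_unitary hA.1 i j

lemma mul_mem_USp {A B : Mat N} (hA : A ∈ USp N) (hB : B ∈ USp N) : A * B ∈ USp N := by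
  refine ⟨mul_mem hA.1 hB.1, ?_⟩
  rw [Matrix.transpose_mul]
  calc Bᵀ * Aᵀ * J N * (A * B) = Bᵀ * (Aᵀ * J N * A) * B := by simp only [Matrix.mul_assoc]
    _ = J N := by rw [hA.2, hB.2]

section Measure

variable {μ : Measure (Mat N)} [IsProbabilityMeasure μ]

lemma ae_mem_USp (hsupp : μ (USp N) = 1) : ∀ᵐ A ∂μ, A ∈ USp N :=
  (mem_ae_iff_prob_eq_one isClosed_USp.measurableSet).2 hsupp

lemma integrable_of_continuous (hsupp : μ (USp N) = 1) {f : Mat N → ℂ} (hf : Continuous f) :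
    Integrable f μ := by
  have h : μ.restrict (USp N) = μ := Measure.restrict_eq_self_of_ae_mem (ae_mem_USp hsupp)
  rw [← h]
  exact hf.continuousOn.integrableOn_compact isCompact_USp

end Measure

lemma transpose_exp_mul_J {X : Mat N} (hX : Xᵀ * J N + J N * X = 0) :
    (NormedSpace.exp X)ᵀ * J N = J N * NormedSpace.exp (-X) := by
  have h1 : Xᵀ = J N * (-X) * (-J N) := by
    have h2 : Xᵀ * J N = -(J N * X) := eq_neg_of_add_eq_zero_left hX
    have h3 : Xᵀ * J N * J N = -(J N * X) * J N := by rw [h2]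
    rw [Matrix.mul_assoc, J_mul_J] at h3
    simpa using h3
  let U : (Mat N)ˣ := ⟨J N, -J N, by simp [J_mul_J], by simp [J_mul_J]⟩
  have h2 : NormedSpace.exp (J N * (-X) * (-J N)) = J N * NormedSpace.exp (-X) * (-J N) :=
    Matrix.exp_units_conj U (-X)
  rw [← Matrix.exp_transpose, h1, h2, Matrix.mul_assoc, Matrix.neg_mul, J_mul_J]
  simp

lemma exp_mem_USp {X : Mat N} (hX : Xᵀ * J N + J N * X = 0) (hX' : Xᴴ = -X) :
    NormedSpace.exp X ∈ USp N := by
  have h : NormedSpace.exp (-X) * NormedSpace.exp X = 1 := by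
    rw [← Matrix.exp_add_of_commute _ _ (Commute.neg_left (Commute.refl X)), neg_add_cancel,
      NormedSpace.exp_zero]
  constructor
  · rw [Matrix.mem_unitaryGroup_iff', Matrix.star_eq_conjTranspose, ← Matrix.exp_conjTranspose,
      hX', h]
  · rw [transpose_exp_mul_J hX, Matrix.mul_assoc, h, Matrix.mul_one]

/-- Entrywise differentiability of a curve of matrices. -/
def HasEntryDeriv (B : ℝ → Mat N) (B' : Mat N) (t : ℝ) : Prop :=
  ∀ i j, HasDerivAt (fun s => B s i j) (B' i j) t

lemma HasEntryDeriv.mul {B C : ℝ → Mat N} {B' C' : Mat N} {t : ℝ} (hB : HasEntryDeriv B B' t)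
    (hC : HasEntryDeriv C C' t) :
    HasEntryDeriv (fun s => B s * C s) (B' * C t + B t * C') t := by
  intro i j
  simp only [Matrix.mul_apply, Matrix.add_apply, ← Finset.sum_add_distrib]
  exact HasDerivAt.fun_sum fun l _ => (hB i l).mul (hC l j)

lemma hasEntryDeriv_const (A : Mat N) (t : ℝ) : HasEntryDeriv (fun _ => A) 0 t :=
  fun i j => hasDerivAt_const t (A i j)

lemma HasEntryDeriv.pow {B : ℝ → Mat N} {X : Mat N} {t : ℝ} (hB : HasEntryDeriv B (X * B t) t)
    (k : ℕ) : HasEntryDeriv (fun s => B s ^ k)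
      (∑ m ∈ Finset.range k, B t ^ m * X * B t ^ (k - m)) t := by
  induction k with
  | zero => simpa using hasEntryDeriv_const (1 : Mat N) t
  | succ k ih =>
    have h := ih.mul hB
    simp only [← pow_succ] at h
    convert h using 1
    rw [Finset.sum_range_succ, Finset.sum_mul]
    congr 1
    · refine Finset.sum_congr rfl fun m hm => ?_
      rw [Nat.succ_sub (Finset.mem_range.1 hm).le, pow_succ]
      simp only [Matrix.mul_assoc]
    · rw [Nat.succ_sub le_rfl, Nat.sub_self, pow_one, Matrix.mul_assoc]

lemma HasEntryDeriv.trace {B : ℝ → Mat N} {B' : Mat N} {t : ℝ} (hB : HasEntryDeriv B B' t) :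
    HasDerivAt (fun s => (B s).trace) B'.trace t :=
  HasDerivAt.fun_sum fun i _ => hB i i

lemma hasEntryDeriv_exp (X : Mat N) (t : ℝ) :
    HasEntryDeriv (fun s => NormedSpace.exp (s • X)) (X * NormedSpace.exp (t • X)) t := by
  let _ : NormedRing (Mat N) := Matrix.linftyOpNormedRing
  let _ : NormedAlgebra ℝ (Mat N) := Matrix.linftyOpNormedAlgebra
  intro i j
  have h := hasDerivAt_exp_smul_const' X t
  exact ((Matrix.entryLinearMap ℝ ℂ i j).toContinuousLinearMap).hasFDerivAt.comp_hasDerivAt t h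

lemma hasEntryDeriv_exp_mul (X A : Mat N) (t : ℝ) :
    HasEntryDeriv (fun s => NormedSpace.exp (s • X) * A) (X * (NormedSpace.exp (t • X) * A)) t := by
  have h := (hasEntryDeriv_exp X t).mul (hasEntryDeriv_const A t)
  rwa [Matrix.mul_zero, add_zero, Matrix.mul_assoc] at h

/-- Evaluation of a trace polynomial at a matrix. -/
def traceEval (A : Mat N) : TracePoly →ₐ[ℂ] ℂ := MvPolynomial.aeval fun n => (A ^ n).trace

/-- Directional derivative of a trace polynomial. -/
def traceDir (A X : Mat N) (f : TracePoly) : ℂ :=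
  traceEval A (MvPolynomial.mkDerivation ℂ (fun l : ℕ =>
    (MvPolynomial.C ((l : ℂ) * (X * A ^ l).trace) : TracePoly)) f)

lemma traceEval_X (A : Mat N) (n : ℕ) : traceEval A (MvPolynomial.X n) = (A ^ n).trace := by
  simp [traceEval]

lemma traceEval_C (A : Mat N) (c : ℂ) : traceEval A (MvPolynomial.C c) = c := by
  rw [← MvPolynomial.algebraMap_eq, AlgHom.commutes, Algebra.algebraMap_self_apply]

lemma traceDir_C (A X : Mat N) (c : ℂ) : traceDir A X (MvPolynomial.C c) = 0 := by
  simp [traceDir]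

lemma traceDir_add (A X : Mat N) (f g : TracePoly) :
    traceDir A X (f + g) = traceDir A X f + traceDir A X g := by
  simp [traceDir]

lemma traceDir_mul_X (A X : Mat N) (f : TracePoly) (n : ℕ) :
    traceDir A X (f * MvPolynomial.X n) = traceDir A X f * (A ^ n).trace +
      traceEval A f * ((n : ℂ) * (X * A ^ n).trace) := by
  simp only [traceDir, Derivation.leibniz, smul_eq_mul, map_add, map_mul, traceEval_X,
    MvPolynomial.mkDerivation_X, traceEval_C]
  ring

lemma trace_sum_pow_mul_mul_pow (X A : Mat N) (n : ℕ) :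
    (∑ m ∈ Finset.range n, A ^ m * X * A ^ (n - m)).trace = (n : ℂ) * (X * A ^ n).trace := by
  have h : ∀ m ∈ Finset.range n, (A ^ m * X * A ^ (n - m)).trace = (X * A ^ n).trace := by
    intro m hm
    rw [Matrix.mul_assoc, Matrix.trace_mul_comm, Matrix.mul_assoc, ← pow_add,
      Nat.sub_add_cancel (Finset.mem_range.1 hm).le]
  rw [Matrix.trace_sum, Finset.sum_congr rfl h]
  simp

lemma hasDerivAt_traceEval {B : ℝ → Mat N} {X : Mat N} {t : ℝ}
    (hB : HasEntryDeriv B (X * B t) t) (f : TracePoly) :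
    HasDerivAt (fun s => traceEval (B s) f) (traceDir (B t) X f) t := by
  induction f using MvPolynomial.induction_on with
  | C a =>
    simp only [traceDir_C, traceEval_C]
    exact hasDerivAt_const _ _
  | add f g hf hg =>
    simp only [traceDir_add, map_add]
    exact hf.add hg
  | mul_X f n hf =>
    simp only [map_mul, traceEval_X, traceDir_mul_X]
    have h := hf.mul (hB.pow n).trace
    rwa [trace_sum_pow_mul_mul_pow] at h

lemma continuous_traceEval (f : TracePoly) : Continuous fun A : Mat N => traceEval A f := by
  induction f using MvPolynomial.induction_on with
  | C a => simpa only [traceEval_C] using continuous_const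
  | add f g hf hg =>
    simp only [map_add]
    exact hf.add hg
  | mul_X f n hf =>
    simp only [map_mul, traceEval_X]
    exact hf.mul (continuous_id.pow n).matrix_trace

lemma continuous_traceDir (X : Mat N) (f : TracePoly) :
    Continuous fun A : Mat N => traceDir A X f := by
  induction f using MvPolynomial.induction_on with
  | C a => simpa only [traceDir_C] using continuous_const
  | add f g hf hg =>
    simp only [traceDir_add]
    exact hf.add hg
  | mul_X f n hf =>
    simp only [traceDir_mul_X]
    exact (hf.mul (continuous_id.pow n).matrix_trace).add ((continuous_traceEval f).mul
      (continuous_const.mul (continuous_const.matrix_mul (continuous_id.pow n)).matrix_trace))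

section Invariance

variable {μ : Measure (Mat N)}

lemma integral_mul_left (hinv : ∀ g ∈ USp N, μ.map (fun A => g * A) = μ) {g : Mat N}
    (hg : g ∈ USp N) {f : Mat N → ℂ} (hf : Continuous f) :
    ∫ A, f (g * A) ∂μ = ∫ A, f A ∂μ := by
  have hm : Continuous fun A : Mat N => g * A := continuous_const.matrix_mul continuous_id
  conv_rhs => rw [← hinv g hg]
  exact (integral_map hm.measurable.aemeasurable hf.aestronglyMeasurable).symm

variable [IsProbabilityMeasure μ]

lemma integral_deriv_eq_zero (hsupp : μ (USp N) = 1)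
    (hinv : ∀ g ∈ USp N, μ.map (fun A => g * A) = μ) {X : Mat N}
    (hX : Xᵀ * J N + J N * X = 0) (hX' : Xᴴ = -X) {f f' : Mat N → ℂ} (hf : Continuous f)
    (hf' : Continuous f') (hd : ∀ (A : Mat N) (t : ℝ),
      HasDerivAt (fun s : ℝ => f (NormedSpace.exp (s • X) * A))
        (f' (NormedSpace.exp (t • X) * A)) t) :
    ∫ A, f' A ∂μ = 0 := by
  have hexp : ∀ t : ℝ, NormedSpace.exp (t • X) ∈ USp N := fun t => by
    refine exp_mem_USp ?_ ?_
    · rw [Matrix.transpose_smul, Matrix.smul_mul, Matrix.mul_smul, ← smul_add, hX, smul_zero]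
    · rw [Matrix.conjTranspose_smul, hX', star_trivial, smul_neg]
  have hmul : ∀ t : ℝ, Continuous fun A : Mat N => NormedSpace.exp (t • X) * A := fun t =>
    continuous_const.matrix_mul continuous_id
  obtain ⟨C, hC⟩ := isCompact_USp.exists_bound_of_continuousOn (f := f') (s := USp N)
    hf'.continuousOn
  have h := (hasDerivAt_integral_of_dominated_loc_of_deriv_le (μ := μ)
    (F := fun (t : ℝ) A => f (NormedSpace.exp (t • X) * A))
    (F' := fun (t : ℝ) A => f' (NormedSpace.exp (t • X) * A)) (x₀ := 0) (s := Set.univ)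
    (bound := fun _ => C) Filter.univ_mem
    (Filter.Eventually.of_forall fun t => (hf.comp (hmul t)).aestronglyMeasurable)
    (integrable_of_continuous hsupp (hf.comp (hmul 0)))
    (hf'.comp (hmul 0)).aestronglyMeasurable
    ((ae_mem_USp hsupp).mono fun A hA t _ => hC _ (mul_mem_USp (hexp t) hA))
    (integrable_const C) (Filter.Eventually.of_forall fun A t _ => hd A t)).2
  simp only [integral_mul_left hinv (hexp _) hf, integral_mul_left hinv (hexp _) hf'] at h
  exact h.unique (hasDerivAt_const _ _)

/-- The derivative of a matrix entry of a power times a trace polynomial. -/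
def entryDir (k : ℕ) (a b : Fin (2 * N)) (f : TracePoly) (A X : Mat N) : ℂ :=
  (∑ m ∈ Finset.range k, A ^ m * X * A ^ (k - m)) a b * traceEval A f +
    (A ^ k) a b * traceDir A X f

lemma traceDir_isLinearMap (A : Mat N) (f : TracePoly) :
    IsLinearMap ℂ fun X => traceDir A X f := by
  induction f using MvPolynomial.induction_on with
  | C a => exact ⟨fun _ _ => by simp [traceDir_C], fun _ _ => by simp [traceDir_C]⟩
  | add f g hf hg =>
    simp only [traceDir_add]
    exact (hf.mk' _ + hg.mk' _).isLinear
  | mul_X f n hf =>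
    constructor
    · intro X Y
      simp only [traceDir_mul_X, hf.map_add, Matrix.add_mul, Matrix.trace_add]
      ring
    · intro c X
      simp only [traceDir_mul_X, hf.map_smul, Matrix.smul_mul, Matrix.trace_smul, smul_eq_mul]
      ring

lemma entryDir_add_smul (k : ℕ) (a b : Fin (2 * N)) (f : TracePoly) (A X Y : Mat N) (c : ℂ) :
    entryDir k a b f A (X + c • Y) = entryDir k a b f A X + c * entryDir k a b f A Y := by
  have h := traceDir_isLinearMap A f
  simp only [entryDir, h.map_add, h.map_smul, smul_eq_mul, Matrix.mul_add, Matrix.add_mul,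
    Matrix.mul_smul, Matrix.smul_mul, Finset.sum_add_distrib, ← Finset.smul_sum,
    Matrix.add_apply, Matrix.smul_apply]
  ring

lemma continuous_entryDir (k : ℕ) (a b : Fin (2 * N)) (f : TracePoly) (X : Mat N) :
    Continuous fun A => entryDir k a b f A X := by
  have h : Continuous fun A : Mat N => ∑ m ∈ Finset.range k, A ^ m * X * A ^ (k - m) :=
    continuous_finsetSum _ fun m _ => ((continuous_id.pow m).matrix_mul
      continuous_const).matrix_mul (continuous_id.pow (k - m))
  exact ((h.matrix_elem a b).mul (continuous_traceEval f)).add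
    (((continuous_id.pow k).matrix_elem a b).mul (continuous_traceDir X f))

lemma integral_entryDir_of_skew (hsupp : μ (USp N) = 1)
    (hinv : ∀ g ∈ USp N, μ.map (fun A => g * A) = μ) {X : Mat N}
    (hX : Xᵀ * J N + J N * X = 0) (hX' : Xᴴ = -X) (k : ℕ) (a b : Fin (2 * N)) (f : TracePoly) :
    ∫ A, entryDir k a b f A X ∂μ = 0 := by
  refine integral_deriv_eq_zero hsupp hinv hX hX' (f := fun A => (A ^ k) a b * traceEval A f)
    (((continuous_id.pow k).matrix_elem a b).mul (continuous_traceEval f))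
    (continuous_entryDir k a b f X) fun A t => ?_
  have h := hasEntryDeriv_exp_mul X A t
  exact (h.pow k a b).mul (hasDerivAt_traceEval h f)

lemma integral_entryDir (hsupp : μ (USp N) = 1)
    (hinv : ∀ g ∈ USp N, μ.map (fun A => g * A) = μ) {X : Mat N}
    (hX : Xᵀ * J N + J N * X = 0) (k : ℕ) (a b : Fin (2 * N)) (f : TracePoly) :
    ∫ A, entryDir k a b f A X ∂μ = 0 := by
  have hXc : Xᴴᵀ * J N + J N * Xᴴ = 0 := by
    have h : J N * Xᴴᵀ = -(Xᴴ * J N) := by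
      have h := congrArg Matrix.conjTranspose hX
      rw [Matrix.conjTranspose_add, Matrix.conjTranspose_mul, Matrix.conjTranspose_mul,
        J_conjTranspose, Matrix.conjTranspose_zero, Matrix.neg_mul, Matrix.mul_neg,
        ← neg_add, neg_eq_zero] at h
      exact eq_neg_of_add_eq_zero_left h
    have h' : J N * (J N * Xᴴᵀ) * J N = -(J N * Xᴴ) * (J N * J N) := by
      rw [h]
      simp only [Matrix.mul_neg, Matrix.neg_mul, Matrix.mul_assoc]
    rw [← Matrix.mul_assoc, J_mul_J] at h'
    simp only [Matrix.mul_neg, Matrix.neg_mul, Matrix.one_mul, Matrix.mul_one, neg_neg] at h'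
    rw [← h', add_neg_cancel]
  have h1 : ∫ A, entryDir k a b f A ((1 / 2 : ℂ) • (X - Xᴴ)) ∂μ = 0 := by
    refine integral_entryDir_of_skew hsupp hinv ?_ ?_ k a b f
    · rw [Matrix.transpose_smul, Matrix.smul_mul, Matrix.mul_smul, ← smul_add,
        Matrix.transpose_sub, Matrix.sub_mul, Matrix.mul_sub, sub_add_sub_comm, hX, hXc, sub_zero,
        smul_zero]
    · rw [Matrix.conjTranspose_smul, Matrix.conjTranspose_sub, Matrix.conjTranspose_conjTranspose,
        ← smul_neg, neg_sub]
      simp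
  have h2 : ∫ A, entryDir k a b f A ((Complex.I / 2) • (X + Xᴴ)) ∂μ = 0 := by
    refine integral_entryDir_of_skew hsupp hinv ?_ ?_ k a b f
    · rw [Matrix.transpose_smul, Matrix.smul_mul, Matrix.mul_smul, ← smul_add,
        Matrix.transpose_add, Matrix.add_mul, Matrix.mul_add, add_add_add_comm, hX, hXc, add_zero,
        smul_zero]
    · rw [Matrix.conjTranspose_smul, Matrix.conjTranspose_add, Matrix.conjTranspose_conjTranspose,
        ← neg_smul, add_comm]
      congr 1
      simp [neg_div]
  have h3 : X = (1 / 2 : ℂ) • (X - Xᴴ) + (-Complex.I) • ((Complex.I / 2) • (X + Xᴴ)) := by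
    rw [smul_smul, show -Complex.I * (Complex.I / 2) = 1 / 2 by
      linear_combination (-1 / 2 : ℂ) * Complex.I_mul_I]
    module
  rw [h3]
  simp only [entryDir_add_smul]
  rw [integral_add (integrable_of_continuous hsupp (continuous_entryDir k a b f _))
    ((integrable_of_continuous hsupp (continuous_entryDir k a b f _)).const_mul _),
    integral_const_mul, h1, h2, mul_zero, add_zero]

/-- The element of the symplectic Lie algebra attached to a matrix unit. -/
def lieUnit (a b : Fin (2 * N)) : Mat N :=
  Matrix.single a b 1 + J N * Matrix.single b a 1 * J N

lemma lieUnit_mem (a b : Fin (2 * N)) :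
    (lieUnit a b)ᵀ * J N + J N * lieUnit a b = 0 := by
  simp only [lieUnit, Matrix.transpose_add, Matrix.transpose_mul, J_transpose,
    Matrix.transpose_single, Matrix.add_mul, Matrix.mul_add, Matrix.neg_mul, Matrix.mul_neg,
    neg_neg]
  rw [← Matrix.mul_assoc (J N) (J N * _), ← Matrix.mul_assoc (J N) (J N), J_mul_J]
  simp only [Matrix.mul_assoc, J_mul_J]
  simp

lemma sum_entry_smul_lieUnit {A : Mat N} (hA : A ∈ USp N) (k : ℕ) :
    ∑ a, ∑ b, (A ^ k) a b • lieUnit a b = A ^ k - Aᴴ ^ k := by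
  rw [conjTranspose_pow_eq hA, sub_neg_eq_add]
  have h : ∀ a b, (A ^ k) a b • (J N * Matrix.single b a 1 * J N) =
      J N * Matrix.single b a ((A ^ k)ᵀ b a) * J N := by
    intro a b
    rw [← Matrix.smul_mul, ← Matrix.mul_smul, Matrix.smul_single, smul_eq_mul, mul_one,
      Matrix.transpose_apply]
  simp only [lieUnit, smul_add, Finset.sum_add_distrib, h, ← Matrix.mul_sum, ← Matrix.sum_mul,
    Matrix.smul_single, smul_eq_mul, mul_one]
  congr 1
  · exact (Matrix.matrix_eq_sum_single _).symm
  · rw [Finset.sum_comm, ← Matrix.matrix_eq_sum_single]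

lemma traceDir_sub_conjTranspose {A : Mat N} (hA : A ∈ USp N) (k : ℕ) (f : TracePoly) :
    traceDir A (A ^ k - Aᴴ ^ k) f = traceEval A (joinField k f) := by
  induction f using MvPolynomial.induction_on with
  | C a => rw [traceDir_C, ← MvPolynomial.algebraMap_eq, Derivation.map_algebraMap, map_zero]
  | add f g hf hg => rw [traceDir_add, hf, hg, map_add, map_add]
  | mul_X f n hf =>
    rw [traceDir_mul_X, hf, Matrix.sub_mul, Matrix.trace_sub, ← pow_add,
      trace_conjTranspose_pow_mul_pow hA, ← Int.natAbs_neg, neg_sub]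
    simp only [Derivation.leibniz, smul_eq_mul, map_add, map_mul, map_sub, map_natCast,
      traceEval_X, joinField, MvPolynomial.mkDerivation_X]
    ring

lemma sum_mul_lieUnit_mul {A : Mat N} (hA : A ∈ USp N) (m n : ℕ) :
    ∑ a : Fin (2 * N), ∑ b, (A ^ m * lieUnit a b * A ^ n : Mat N) a b =
      (A ^ m).trace * (A ^ n).trace + (A ^ ((n : ℤ) - m).natAbs).trace := by
  have h : ∀ (P Q : Mat N) (a b c d : Fin (2 * N)),
      (P * Matrix.single a b (1 : ℂ) * Q) c d = P c a * Q b d := by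
    intro P Q a b c d
    rw [Matrix.mul_apply, Finset.sum_eq_single b]
    · simp
    · intro x _ hx
      rw [Matrix.mul_single_apply_of_ne _ _ _ _ _ hx, zero_mul]
    · simp
  have e : ∀ a b : Fin (2 * N), (A ^ m * lieUnit a b * A ^ n) a b =
      (A ^ m) a a * (A ^ n) b b + (A ^ m * J N) a b * (J N * A ^ n) a b := by
    intro a b
    rw [← h, ← h, ← Matrix.add_apply, lieUnit]
    simp only [Matrix.mul_add, Matrix.add_mul, Matrix.mul_assoc]
  simp only [e, Finset.sum_add_distrib]
  congr 1
  · simp only [Matrix.trace, Matrix.diag_apply, Finset.sum_mul_sum]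
  · rw [← trace_conjTranspose_pow_mul_pow hA, conjTranspose_pow_eq hA]
    have : -(J N * (A ^ m)ᵀ * J N) * A ^ n = (A ^ m * J N)ᵀ * (J N * A ^ n) := by
      rw [Matrix.transpose_mul, J_transpose]
      simp only [Matrix.neg_mul, Matrix.mul_assoc]
    rw [this, Matrix.trace, Finset.sum_comm]
    simp only [Matrix.diag_apply, Matrix.mul_apply (M := (A ^ m * J N)ᵀ), Matrix.transpose_apply]

lemma sum_entryDir_lieUnit {A : Mat N} (hA : A ∈ USp N) (k : ℕ) (f : TracePoly) :
    ∑ a, ∑ b, entryDir k a b f A (lieUnit a b) = traceEval A (schwingerDyson k f) := by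
  simp only [entryDir, Finset.sum_add_distrib, ← Finset.sum_mul]
  rw [schwingerDyson, map_add, map_mul, ← traceDir_sub_conjTranspose hA,
    ← sum_entry_smul_lieUnit hA]
  congr 1
  · congr 1
    simp only [Matrix.sum_apply, splitPoly, map_sum, map_add, map_mul, traceEval_X]
    rw [Finset.sum_congr rfl fun a _ => Finset.sum_comm, Finset.sum_comm]
    refine Finset.sum_congr rfl fun m hm => ?_
    rw [sum_mul_lieUnit_mul hA, Nat.cast_sub (Finset.mem_range.1 hm).le]
    congr 4
    ring
  · change _ = (traceDir_isLinearMap A f).mk' _ (∑ a, ∑ b, (A ^ k) a b • lieUnit a b)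
    simp only [map_sum, map_smul, IsLinearMap.mk'_apply, smul_eq_mul]

/-- The expectation of a trace polynomial. -/
def traceExpect (μ : Measure (Mat N)) [IsProbabilityMeasure μ] (hsupp : μ (USp N) = 1) :
    TracePoly →ₗ[ℂ] ℂ where
  toFun f := ∫ A, traceEval A f ∂μ
  map_add' f g := by
    simp only [map_add]
    exact integral_add (integrable_of_continuous hsupp (continuous_traceEval f))
      (integrable_of_continuous hsupp (continuous_traceEval g))
  map_smul' c f := by
    simp only [map_smul, smul_eq_mul, RingHom.id_apply]
    exact integral_const_mul _ _

lemma traceExpect_schwingerDyson (hsupp : μ (USp N) = 1)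
    (hinv : ∀ g ∈ USp N, μ.map (fun A => g * A) = μ) (k : ℕ) (f : TracePoly) :
    traceExpect μ hsupp (schwingerDyson k f) = 0 := by
  have h : traceExpect μ hsupp (schwingerDyson k f) =
      ∫ A, ∑ a, ∑ b, entryDir k a b f A (lieUnit a b) ∂μ :=
    integral_congr_ae ((ae_mem_USp hsupp).mono fun A hA => (sum_entryDir_lieUnit hA k f).symm)
  have hentry : ∀ a b, Integrable (fun A => entryDir k a b f A (lieUnit a b)) μ := fun a b =>
    integrable_of_continuous hsupp (continuous_entryDir k a b f _)
  rw [h, integral_finsetSum _ fun a _ => integrable_finsetSum _ fun b _ => hentry a b]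
  refine Finset.sum_eq_zero fun a _ => ?_
  rw [integral_finsetSum _ fun b _ => hentry a b]
  exact Finset.sum_eq_zero fun b _ => integral_entryDir hsupp hinv (lieUnit_mem a b) k a b f

end Invariance

lemma aeval_chebyshevC {R : Type*} [Ring R] [Algebra ℂ R] {a b : R} (hab : a * b = 1)
    (hba : b * a = 1) (k : ℕ) :
    Polynomial.aeval (a + b) (Polynomial.Chebyshev.C ℂ k) = a ^ k + b ^ k := by
  induction k using Nat.twoStepInduction with
  | zero => simp [one_add_one_eq_two, map_ofNat]
  | one => simp
  | more k h1 h2 =>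
    push_cast at h2 ⊢
    rw [Polynomial.Chebyshev.C_add_two, map_sub, map_mul, Polynomial.aeval_X, h1, h2, add_mul,
      mul_add, mul_add, pow_succ' b k, pow_succ' a k, ← mul_assoc a b, hab, ← mul_assoc b a, hba,
      ← pow_succ' a k, ← pow_succ' b k, ← pow_succ', ← pow_succ']
    simp only [one_mul]
    abel

lemma exists_unit_add_inv (c : ℂ) : ∃ z : ℂˣ, (z : ℂ) + ((z⁻¹ : ℂˣ) : ℂ) = c := by
  obtain ⟨s, hs⟩ := IsAlgClosed.exists_pow_nat_eq (c ^ 2 - 4) two_pos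
  have h : (c + s) / 2 * ((c - s) / 2) = 1 := by linear_combination (-1 / 4 : ℂ) * hs
  exact ⟨⟨(c + s) / 2, (c - s) / 2, h, by rw [mul_comm, h]⟩, by
    change (c + s) / 2 + (c - s) / 2 = c
    ring⟩

lemma even_card_of_transpose_eq_neg {n : Type*} [Fintype n] [DecidableEq n] {K L : Matrix n n ℂ}
    (hK : Kᵀ = -K) (hKL : K * L = 1) : Even (Fintype.card n) := by
  have h0 : K.det ≠ 0 := fun h => by
    have := congrArg Matrix.det hKL
    rw [Matrix.det_mul, h, zero_mul, Matrix.det_one] at this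
    exact zero_ne_one this
  have h : K.det = (-1) ^ Fintype.card n * K.det := by
    rw [← Matrix.det_neg, ← hK, Matrix.det_transpose]
  by_contra hodd
  rw [(Nat.not_even_iff_odd.1 hodd).neg_one_pow] at h
  exact h0 (by linear_combination h / 2)

lemma even_card_fiber {n : Type*} [Fintype n] [DecidableEq n] {K L : Matrix n n ℂ} {d : n → ℝ}
    (hK : Kᵀ = -K) (hKL : K * L = 1) (hd : ∀ i j, (d i : ℂ) * K i j = K i j * d j) (x : ℝ) :
    Even (Fintype.card {i // d i = x}) := by
  refine even_card_of_transpose_eq_neg (K := K.submatrix Subtype.val Subtype.val)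
    (L := L.submatrix Subtype.val Subtype.val) ?_ ?_
  · rw [Matrix.transpose_submatrix, hK, Matrix.submatrix_neg]
    rfl
  · ext i j
    rw [Matrix.mul_apply, ← Matrix.submatrix_one (Subtype.val : {i // d i = x} → n)
      Subtype.val_injective, Matrix.submatrix_apply, ← hKL, Matrix.mul_apply]
    simp only [Matrix.submatrix_apply]
    refine Fintype.sum_of_injective _ Subtype.val_injective _ (fun l => K i l * L l j)
      (fun l hl => ?_) fun _ => rfl
    have hl' : d l ≠ x := fun h => hl ⟨⟨l, h⟩, rfl⟩
    have h : ((d i - d l : ℝ) : ℂ) * K i l = 0 := by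
      push_cast
      linear_combination hd i l
    rw [i.2, mul_eq_zero, Complex.ofReal_eq_zero, sub_eq_zero] at h
    rw [h.resolve_left hl'.symm, zero_mul]

lemma exists_sum_eq_two_mul {d : Fin (2 * N) → ℝ}
    (hd : ∀ x, Even (Fintype.card {i // d i = x})) :
    ∃ c : Fin N → ℝ, ∀ g : ℝ → ℂ, ∑ i, g (d i) = 2 * ∑ j, g (c j) := by
  obtain ⟨t, ht⟩ := Multiset.exists_smul_of_dvd_count (Finset.univ.val.map d) (k := 2)
      fun x _ => Even.two_dvd <| by
    have h := hd x
    rw [Fintype.card_subtype, Finset.card_def, Finset.filter_val] at h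
    rw [Multiset.count_map]
    simpa only [eq_comm] using h
  have hcard : t.card = N := by
    have := congrArg Multiset.card ht
    simp at this
    omega
  obtain ⟨l, rfl⟩ : ∃ l : List ℝ, t = l := ⟨t.toList, t.coe_toList.symm⟩
  obtain rfl : l.length = N := hcard
  refine ⟨l.get, fun g => ?_⟩
  have h := congrArg (fun s => (s.map g).sum) ht
  simp only [Multiset.map_map, Multiset.map_nsmul, Multiset.sum_nsmul] at h
  refine h.trans ?_
  rw [nsmul_eq_mul, ← List.sum_ofFn]
  simp

lemma trace_aeval_of_conj {n : Type*} [Fintype n] [DecidableEq n] {H U V : Matrix n n ℂ}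
    {d : n → ℂ} (hVU : V * U = 1) (hH : H = U * Matrix.diagonal d * V) (p : Polynomial ℂ) :
    (Polynomial.aeval H p).trace = ∑ i, p.eval (d i) := by
  have hpow : ∀ k : ℕ, H ^ k = U * Matrix.diagonal d ^ k * V := by
    intro k
    induction k with
    | zero => simp [mul_eq_one_comm.1 hVU]
    | succ k ih =>
      rw [pow_succ, ih, hH, pow_succ]
      simp only [Matrix.mul_assoc]
      rw [← Matrix.mul_assoc V U, hVU, Matrix.one_mul]
  induction p using Polynomial.induction_on' with
  | add p q hp hq => simp only [map_add, Matrix.trace_add, hp, hq, Polynomial.eval_add,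
      Finset.sum_add_distrib]
  | monomial k a =>
    rw [Polynomial.aeval_monomial, hpow, ← Algebra.smul_def, Matrix.trace_smul,
      Matrix.trace_mul_comm, ← Matrix.mul_assoc, hVU, Matrix.one_mul, Matrix.diagonal_pow,
      Matrix.trace_diagonal, Finset.smul_sum]
    simp

lemma exists_trace_pow_eq {A : Mat N} (hA : A ∈ USp N) :
    ∃ z : Fin N → ℂˣ, ∀ k : ℕ, (A ^ k).trace = ∑ j, ((z j : ℂ) ^ k + ((z j)⁻¹ : ℂˣ) ^ k) := by
  have hAA : A * Aᴴ = 1 := Matrix.mem_unitaryGroup_iff.1 hA.1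
  have hAA' : Aᴴ * A = 1 := Matrix.mem_unitaryGroup_iff'.1 hA.1
  have hH : (A + Aᴴ).IsHermitian := Matrix.isHermitian_add_transpose_self A
  have hHJ : (A + Aᴴ)ᵀ * J N = J N * (A + Aᴴ) := by
    have h1 := conjTranspose_pow_eq hA 1
    rw [pow_one, pow_one] at h1
    have h2 : Aᴴᵀ * J N = J N * A := by
      rw [h1, Matrix.transpose_neg, Matrix.transpose_mul, Matrix.transpose_mul,
        Matrix.transpose_transpose, J_transpose]
      simp [Matrix.mul_assoc, J_mul_J]
    rw [Matrix.transpose_add, Matrix.add_mul, Matrix.mul_add, transpose_mul_J hA, h2, add_comm]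
  set U : Mat N := (hH.eigenvectorUnitary : Mat N)
  have hUU : star U * U = 1 := Unitary.coe_star_mul_self hH.eigenvectorUnitary
  have hUU' : U * star U = 1 := Unitary.coe_mul_star_self hH.eigenvectorUnitary
  set D : Mat N := Matrix.diagonal (fun i => (hH.eigenvalues i : ℂ)) with hD
  have hspec : A + Aᴴ = U * D * star U := hH.spectral_theorem
  have hUUt : Uᵀ * (star U)ᵀ = 1 := by rw [← Matrix.transpose_mul, hUU, Matrix.transpose_one]
  have hcomm : D * (Uᵀ * J N * U) = Uᵀ * J N * U * D := by
    have h : Uᵀ * ((A + Aᴴ)ᵀ * J N) * U = Uᵀ * (J N * (A + Aᴴ)) * U := by rw [hHJ]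
    rw [hspec, Matrix.transpose_mul, Matrix.transpose_mul, hD, Matrix.diagonal_transpose,
      ← hD] at h
    calc D * (Uᵀ * J N * U) = (Uᵀ * (star U)ᵀ) * D * Uᵀ * J N * U := by
          rw [hUUt]; simp only [Matrix.one_mul, Matrix.mul_assoc]
      _ = Uᵀ * J N * U * D * (star U * U) := by simpa only [Matrix.mul_assoc] using h
      _ = _ := by rw [hUU, Matrix.mul_one]
  have hK : (Uᵀ * J N * U)ᵀ = -(Uᵀ * J N * U) := by
    simp [Matrix.transpose_mul, J_transpose, Matrix.mul_assoc]
  have hKL : Uᵀ * J N * U * -(star U * J N * (star U)ᵀ) = 1 := by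
    calc _ = -(Uᵀ * J N * (U * star U) * J N * (star U)ᵀ) := by
          simp only [Matrix.mul_neg, Matrix.mul_assoc]
      _ = Uᵀ * (star U)ᵀ := by
          rw [hUU', Matrix.mul_one, Matrix.mul_assoc Uᵀ, J_mul_J]; simp
      _ = 1 := hUUt
  obtain ⟨c, hc⟩ := exists_sum_eq_two_mul (d := hH.eigenvalues) fun x =>
    even_card_fiber hK hKL (fun i j => by
      have := congrFun (congrFun hcomm i) j
      rwa [hD, Matrix.diagonal_mul, Matrix.mul_diagonal] at this) x
  choose z hz using fun j => exists_unit_add_inv (c j)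
  refine ⟨z, fun k => ?_⟩
  have h1 := trace_aeval_of_conj hUU hspec (Polynomial.Chebyshev.C ℂ k)
  rw [aeval_chebyshevC hAA hAA', Matrix.trace_add, trace_conjTranspose_pow hA,
    hc fun x => (Polynomial.Chebyshev.C ℂ k).eval (x : ℂ), ← two_mul] at h1
  rw [mul_left_cancel₀ two_ne_zero h1]
  refine Finset.sum_congr rfl fun j _ => ?_
  rw [← hz j, ← Polynomial.coe_aeval_eq_eval, aeval_chebyshevC (z j).mul_inv (z j).inv_mul]

lemma exists_evalTorus_toTorus {A : Mat N} (hA : A ∈ USp N) :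
    ∃ z : Fin N → ℂˣ, ∀ f, evalTorus z (toTorus N f) = traceEval A f := by
  obtain ⟨z, hz⟩ := exists_trace_pow_eq hA
  refine ⟨z, fun f => ?_⟩
  have h : (evalTorus z).comp (toTorus N) = traceEval A := by
    refine MvPolynomial.algHom_ext fun n => ?_
    rw [AlgHom.comp_apply, toTorus_X, traceEval_X, hz, powerSum, map_sum]
    refine Finset.sum_congr rfl fun j _ => ?_
    rw [cosPow, map_add, evalTorus_coordPow, evalTorus_coordPow]
    simp
  exact DFunLike.congr_fun h f

lemma traceExpect_eq_const {μ : Measure (Mat N)} [IsProbabilityMeasure μ] (hsupp : μ (USp N) = 1)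
    (f : TracePoly) (c : ℂ) (h : toTorus N f = algebraMap ℂ _ c) : traceExpect μ hsupp f = c := by
  have h' : traceExpect μ hsupp f = ∫ _, c ∂μ :=
    integral_congr_ae ((ae_mem_USp hsupp).mono fun A hA => by
      obtain ⟨z, hz⟩ := exists_evalTorus_toTorus hA
      change traceEval A f = c
      rw [← hz, h, AlgHom.commutes, Algebra.algebraMap_self_apply])
  rw [h', integral_const, probReal_univ, one_smul]

section Moments

variable {μ : Measure (Mat N)} [IsProbabilityMeasure μ]

lemma trace_pow_eq_ofReal {A : Mat N} (hA : A ∈ USp N) (k : ℕ) :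
    (A ^ k).trace = ((A ^ k).trace.re : ℂ) := by
  refine (Complex.conj_eq_iff_re.1 ?_).symm
  rw [starRingEnd_apply, ← Matrix.trace_conjTranspose, Matrix.conjTranspose_pow,
    trace_conjTranspose_pow hA]

lemma integrable_trace_sq (hsupp : μ (USp N) = 1) (k : ℕ) :
    Integrable (fun A : Mat N => (A ^ k).trace.re ^ 2) μ := by
  have h : Continuous fun A : Mat N => ((A ^ k).trace.re ^ 2 : ℝ) :=
    (Complex.continuous_re.comp (continuous_id.pow k).matrix_trace).pow 2
  exact (integrable_of_continuous hsupp (Complex.continuous_ofReal.comp h)).re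

/-- The second moment of the trace of the `k`-th power under Haar measure. -/
theorem integral_trace_sq (hsupp : μ (USp N) = 1)
    (hinv : ∀ g ∈ USp N, μ.map (fun A => g * A) = μ) {k : ℕ} (hk : 1 ≤ k) :
    ∫ A, (A ^ k).trace.re ^ 2 ∂μ = min (k : ℝ) (2 * N) + eta N k := by
  have h := functional_X_sq (traceExpect μ hsupp) (traceExpect_schwingerDyson hsupp hinv)
    (traceExpect_eq_const hsupp) k hk
  have h' : traceExpect μ hsupp (MvPolynomial.X k ^ 2) =
      ∫ A, (((A ^ k).trace.re ^ 2 : ℝ) : ℂ) ∂μ :=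
    integral_congr_ae ((ae_mem_USp hsupp).mono fun A hA => by
      change traceEval A _ = _
      rw [map_pow, traceEval_X, trace_pow_eq_ofReal hA k]
      push_cast
      simp)
  rw [h', integral_complex_ofReal, ← Complex.ofReal_intCast] at h
  have e1 : (Even (k : ℤ) ∧ k ≤ 2 * N) ↔ (Even k ∧ 1 ≤ k ∧ k ≤ 2 * N) := by
    rw [Int.even_coe_nat]
    exact and_congr_right fun _ => by omega
  have e2 : ((k : ℤ) ≤ 2 * N) ↔ k ≤ 2 * N := by omega
  rw [Complex.ofReal_injective h, eta, eps]
  simp only [e1, e2, Nat.cast_le]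
  push_cast
  ring

lemma eta_le (k : ℕ) : eta N k ≤ 2 := by
  rw [eta, eps]
  split_ifs <;> norm_num

lemma integral_tsum_trace_sq (hsupp : μ (USp N) = 1)
    (hinv : ∀ g ∈ USp N, μ.map (fun A => g * A) = μ) :
    ∫ A, (∑' k : ℕ, ((A ^ (k + 1)).trace.re) ^ 2 / ((k : ℝ) + 1) ^ 2) ∂μ =
      ∑' k : ℕ, (min ((k : ℝ) + 1) (2 * (N : ℝ)) + eta N (k + 1)) / ((k : ℝ) + 1) ^ 2 := by
  have hval : ∀ k : ℕ, ∫ A, ((A ^ (k + 1)).trace.re) ^ 2 / ((k : ℝ) + 1) ^ 2 ∂μ =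
      (min ((k : ℝ) + 1) (2 * (N : ℝ)) + eta N (k + 1)) / ((k : ℝ) + 1) ^ 2 := fun k => by
    rw [integral_div, integral_trace_sq hsupp hinv k.succ_pos, Nat.cast_succ]
  rw [← integral_tsum_of_summable_integral_norm
    (fun k => (integrable_trace_sq hsupp (k + 1)).div_const _)]
  · exact tsum_congr hval
  · have hnorm : ∀ (k : ℕ) (A : Mat N), ‖((A ^ (k + 1)).trace.re) ^ 2 / ((k : ℝ) + 1) ^ 2‖ =
        ((A ^ (k + 1)).trace.re) ^ 2 / ((k : ℝ) + 1) ^ 2 := fun k A =>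
      Real.norm_of_nonneg (by positivity)
    simp only [hnorm]
    refine Summable.of_nonneg_of_le (fun k => integral_nonneg fun A => by positivity) (fun k => ?_)
      (((summable_nat_add_iff 1).2
        (Real.summable_one_div_nat_pow.2 one_lt_two)).mul_left (2 * (N : ℝ) + 2))
    rw [hval, mul_one_div, Nat.cast_succ]
    gcongr
    · exact min_le_right _ _
    · exact eta_le _

end Moments

end SymplecticTrace

/-- For `A` Haar-distributed on the compact symplectic group `USp(2N)`,
`E[ Σ_{k≥1} Tr(A^k)²/k² ] = Σ_{k≥1} (min{k, 2N} + η(k))/k²`.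
(The trace of `A^k` is real, so it is recorded here by its real part.) -/
theorem expected_traceSum_symplectic
    (N : ℕ) (hN : 1 ≤ N)
    (μ : Measure (Matrix (Fin (2 * N)) (Fin (2 * N)) ℂ)) [IsProbabilityMeasure μ]
    (hsupp : μ (USp N) = 1)
    (hinv : ∀ g ∈ USp N, μ.map (fun A => g * A) = μ) :
    ∫ A, (∑' k : ℕ, ((A ^ (k + 1)).trace.re) ^ 2 / ((k : ℝ) + 1) ^ 2) ∂μ
      = ∑' k : ℕ, (min ((k : ℝ) + 1) (2 * (N : ℝ)) + eta N (k + 1)) / ((k : ℝ) + 1) ^ 2 := by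
  exact SymplecticTrace.integral_tsum_trace_sq hsupp hinv
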